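/- arXiv:1708.07944 — 3 statements merged into one kernel-verified Lean document; each statement's English description precedes it below -/
import Mathlib

section
/- Let D̃ be a finitely generated D-subalgebra of Ω with D ⊆ D̃ ⊆ Ω, and let Ũ be a basic open subset of Hom_k(D̃,k̄). Then the set { φ|_D : φ ∈ Ũ } of restrictions to D of elements of Ũ contains a basic open subset of Hom_k(D,k̄). -/
set_option linter.unusedSectionVars false
set_option linter.unusedVariables false

section Base

variable {Ω : Type*} [Field Ω] [IsAlgClosed Ω] [CharZero Ω]
variable (k : Type*) [Field k] [Algebra k Ω]
variable (kbar : Type*) [Field kbar] [Algebra k kbar] [IsAlgClosure k kbar]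

/-- `Γ` is (the carrier set of) a finitely generated subgroup of the additive group `(Ω,+)`
or of the multiplicative group `(Ω∖{0},·)`. -/
def IsFGAddOrMulSubgroup (Γ : Set Ω) : Prop :=
  (∃ H : AddSubgroup Ω, H.FG ∧ Γ = (H : Set Ω)) ∨
  (∃ H : Subgroup Ωˣ, H.FG ∧ Γ = Units.val '' (H : Set Ωˣ))

/-- The `D`-subalgebra `D[Γ]` of `Ω` generated by `Γ`. -/
def algAdj (D : Subalgebra k Ω) (Γ : Set Ω) : Subalgebra k Ω :=
  Algebra.adjoin k ((D : Set Ω) ∪ Γ)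

theorem le_algAdj (D : Subalgebra k Ω) (Γ : Set Ω) : D ≤ algAdj k D Γ :=
  fun _ hx => Algebra.subset_adjoin (Set.mem_union_left _ hx)

theorem subset_algAdj (D : Subalgebra k Ω) (Γ : Set Ω) :
    Γ ⊆ (algAdj k D Γ : Set Ω) :=
  fun _ hx => Algebra.subset_adjoin (Set.mem_union_right _ hx)

/-- `ℬ(D,Γ)`: restrictions to `D` of the `k`-homomorphisms `D[Γ] → k̄` injective on `Γ`. -/
def specB (D : Subalgebra k Ω) (Γ : Set Ω) : Set (↥D →ₐ[k] kbar) :=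
  { φ | ∃ ψ : ↥(algAdj k D Γ) →ₐ[k] kbar,
      (∀ (a b : Ω) (ha : a ∈ Γ) (hb : b ∈ Γ),
        ψ ⟨a, subset_algAdj k D Γ ha⟩ = ψ ⟨b, subset_algAdj k D Γ hb⟩ → a = b) ∧
      ψ.comp (Subalgebra.inclusion (le_algAdj k D Γ)) = φ }

/-- A basic open subset of `Hom_k(D,k̄)`: a finite intersection of sets `ℬ(D,Γ)`. -/
def IsBasicOpen (D : Subalgebra k Ω) (U : Set (↥D →ₐ[k] kbar)) : Prop :=
  ∃ s : Finset (Set Ω), s.Nonempty ∧ (∀ Γ ∈ s, IsFGAddOrMulSubgroup Γ) ∧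
    U = ⋂ Γ ∈ s, specB k kbar D Γ

/-- The Zariski closed subset `𝒱(I)` of `Hom_k(D,k̄)`. -/
def specV (D : Subalgebra k Ω) (I : Ideal ↥D) : Set (↥D →ₐ[k] kbar) :=
  { φ | ∀ a ∈ I, φ a = 0 }

/-- Density in the Zariski topology on `Hom_k(D,k̄)` (whose closed sets are the `𝒱(I)`). -/
def ZariskiDense (D : Subalgebra k Ω) (U : Set (↥D →ₐ[k] kbar)) : Prop :=
  ∀ I : Ideal ↥D, U ⊆ specV k kbar D I → specV k kbar D I = Set.univ

end Base

open Polynomial in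
/-- If `α` has large degree over `E`, then a polynomial over `E` of small degree shares no root with
the translate by `α` of another one. -/
theorem isCoprime_comp_X_add_C_of_lt_natDegree_minpoly {Ω : Type*} [Field Ω] [IsAlgClosed Ω]
    {K : Type*} [Field K] [Algebra K Ω] (E : IntermediateField K Ω) {α : Ω} {d : ℕ}
    (hα : d * d < (minpoly E α).natDegree) {p q : Polynomial Ω}
    (hp : p ≠ 0) (hq : q ≠ 0) (hpd : p.natDegree ≤ d) (hqd : q.natDegree ≤ d)
    (hpE : ∀ i, p.coeff i ∈ E) (hqE : ∀ i, q.coeff i ∈ E) :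
    IsCoprime p (q.comp (X + C α)) := by
  have key : ∀ (r : Polynomial Ω) (b : Ω), r ≠ 0 → r.natDegree ≤ d → (∀ i, r.coeff i ∈ E) →
      r.eval b = 0 → IsIntegral E b ∧ Module.finrank E (IntermediateField.adjoin E {b}) ≤ d := by
    intro r b hr hrd hrE hrb
    have hl : r ∈ lifts (algebraMap E Ω) := by
      rw [lifts_iff_coeff_lifts]
      intro i
      exact ⟨⟨_, hrE i⟩, rfl⟩
    obtain ⟨r', hr', hdeg⟩ := exists_degree_eq_of_mem_lifts hl
    have h0 : r' ≠ 0 := by rintro rfl; simp at hr'; exact hr hr'.symm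
    have hb : aeval b r' = 0 := by
      rw [aeval_def, ← eval_map, hr', hrb]
    have hint : IsIntegral E b := IsAlgebraic.isIntegral ⟨r', h0, hb⟩
    refine ⟨hint, ?_⟩
    rw [IntermediateField.adjoin.finrank hint]
    exact (natDegree_le_natDegree (minpoly.degree_le_of_ne_zero E b h0 hb)).trans
      ((natDegree_eq_of_degree_eq hdeg).trans_le hrd)
  rw [isCoprime_iff_aeval_ne_zero_of_isAlgClosed Ω Ω]
  intro b
  by_contra! hcon
  obtain ⟨h1, h2⟩ := hcon
  simp only [coe_aeval_eq_eval, eval_comp, eval_add, eval_X, eval_C] at h1 h2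
  obtain ⟨i1, f1⟩ := key p b hp hpd hpE h1
  obtain ⟨i2, f2⟩ := key q (b + α) hq hqd hqE h2
  have hmem : α ∈ IntermediateField.adjoin E {b} ⊔ IntermediateField.adjoin E {b + α} := by
    have e1 : b ∈ IntermediateField.adjoin E {b} ⊔ IntermediateField.adjoin E {b + α} :=
      (le_sup_left : IntermediateField.adjoin E {b} ≤ _)
        (IntermediateField.mem_adjoin_simple_self E b)
    have e2 : b + α ∈ IntermediateField.adjoin E {b} ⊔ IntermediateField.adjoin E {b + α} :=
      (le_sup_right : IntermediateField.adjoin E {b + α} ≤ _)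
        (IntermediateField.mem_adjoin_simple_self E (b + α))
    simpa using sub_mem e2 e1
  have := IntermediateField.adjoin.finiteDimensional i1
  have := IntermediateField.adjoin.finiteDimensional i2
  have hfin : FiniteDimensional E
    ↥(IntermediateField.adjoin E {b} ⊔ IntermediateField.adjoin E {b + α}) := inferInstance
  have hint : IsIntegral E α := by simpa using i2.sub i1
  have hle : IntermediateField.adjoin E {α} ≤
      IntermediateField.adjoin E {b} ⊔ IntermediateField.adjoin E {b + α} := by
    simpa using hmem
  have c1 := IntermediateField.finrank_le_of_le_right hle
  have c2 := IntermediateField.finrank_sup_le (IntermediateField.adjoin E {b})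
    (IntermediateField.adjoin E {b + α})
  rw [IntermediateField.adjoin.finrank hint] at c1
  have := Nat.mul_le_mul f1 f2
  omega

/-- The determinant of a matrix with entries in a submodule lies in a power of the submodule. -/
theorem Matrix.det_mem_pow {A : Type*} [CommRing A] {n : Type*} [Fintype n] [DecidableEq n]
    (V : Submodule ℤ A) (M : Matrix n n A) (hM : ∀ i j, M i j ∈ V) :
    M.det ∈ V ^ Fintype.card n := by
  rw [Matrix.det_apply]
  refine Submodule.sum_mem _ fun σ _ => ?_
  have : ∏ i, M (σ i) i ∈ V ^ Fintype.card n := by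
    have key : ∀ s : Finset n, ∏ i ∈ s, M (σ i) i ∈ V ^ s.card := by
      intro s
      induction s using Finset.induction_on with
      | empty => simpa using Submodule.one_le.mp (le_refl (1 : Submodule ℤ A))
      | insert a s ha ih =>
        rw [Finset.prod_insert ha, Finset.card_insert_of_notMem ha, pow_succ']
        exact Submodule.mul_mem_mul (hM _ _) ih
    exact key Finset.univ
  rcases Int.units_eq_one_or (Equiv.Perm.sign σ) with h | h <;> simp [h, this]

open Polynomial in
/-- The degree of an algebraic element does not drop when a transcendental element is adjoined. -/
theorem natDegree_minpoly_le_adjoin_transcendental {Ω : Type*} [Field Ω]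
    {E : Type*} [Field E] [Algebra E Ω] {s α : Ω} (hs : Transcendental E s)
    (hα : IsAlgebraic E α) :
    (minpoly E α).natDegree ≤ (minpoly (IntermediateField.adjoin E {s}) α).natDegree := by
  open scoped IntermediateField.algebraAdjoinAdjoin in
  have hli : LinearIndependent (Algebra.adjoin E {s})
      (fun i : Fin (minpoly E α).natDegree => α ^ (i : ℕ)) := by
    rw [Fintype.linearIndependent_iff]
    intro g hg
    have hp : ∀ i, ∃ p : E[X], aeval s p = (g i : Ω) := fun i => by
      exact (Algebra.adjoin_singleton_eq_range_aeval E s).le (g i).2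
    choose p hp using hp
    have : Algebra.IsAlgebraic E (IntermediateField.adjoin E {α}) :=
      IntermediateField.isAlgebraic_adjoin_simple hα.isIntegral
    have hsA : Transcendental (IntermediateField.adjoin E {α}) s := hs.extendScalars _
    set a := IntermediateField.AdjoinSimple.gen E α
    have hQ : ∑ i, (p i).map (algebraMap E (IntermediateField.adjoin E {α})) *
        C (a ^ (i : ℕ)) = 0 := by
      apply (transcendental_iff.mp hsA)
      rw [map_sum, ← hg]
      refine Finset.sum_congr rfl fun i _ => ?_
      rw [map_mul, aeval_map_algebraMap, hp, aeval_C, Algebra.smul_def]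
      rfl
    have hli2 := linearIndependent_pow (K := E) α
    rw [Fintype.linearIndependent_iff] at hli2
    have hcoef : ∀ j i, (p i).coeff j = 0 := by
      intro j
      apply hli2
      have := congrArg (fun q : (IntermediateField.adjoin E {α})[X] => ((q.coeff j : _) : Ω)) hQ
      simp only [finsetSum_coeff, coeff_mul_C, coeff_map, coeff_zero] at this
      push_cast at this
      refine Eq.trans ?_ this
      refine Finset.sum_congr rfl fun i _ => ?_
      rw [Algebra.smul_def]
      rfl
    intro i
    have h0 : p i = 0 := by ext j; simpa using hcoef j i
    apply Subtype.ext
    rw [← hp i, h0]; simp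
  open scoped IntermediateField.algebraAdjoinAdjoin in
  rw [LinearIndependent.iff_fractionRing (R := Algebra.adjoin E {s})
    (K := IntermediateField.adjoin E {s}), Fintype.linearIndependent_iff] at hli
  by_contra! hlt
  have hint : IsIntegral (IntermediateField.adjoin E {s}) α := hα.isIntegral.tower_top
  have hm := minpoly.aeval (IntermediateField.adjoin E {s}) α
  rw [aeval_eq_sum_range' hlt, ← Fin.sum_univ_eq_sum_range
    (fun i => (minpoly (IntermediateField.adjoin E {s}) α).coeff i • α ^ i)] at hm
  have := hli (fun i => (minpoly (IntermediateField.adjoin E {s}) α).coeff i) hm ⟨_, hlt⟩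
  simp only [coeff_natDegree, (minpoly.monic hint).leadingCoeff] at this
  exact one_ne_zero this

theorem natDegree_minpoly_le_mul_adjoin {Ω : Type*} [Field Ω]
    {E : Type*} [Field E] [Algebra E Ω] {s α : Ω} (hs : IsAlgebraic E s)
    (hα : IsAlgebraic E α) :
    (minpoly E α).natDegree ≤ (minpoly E s).natDegree *
      (minpoly (IntermediateField.adjoin E {s}) α).natDegree := by
  have hint : IsIntegral (IntermediateField.adjoin E {s}) α := hα.isIntegral.tower_top
  rw [← IntermediateField.adjoin.finrank hint, ← IntermediateField.adjoin.finrank hs.isIntegral,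
    ← IntermediateField.adjoin.finrank hα.isIntegral]
  have := IntermediateField.adjoin.finiteDimensional hs.isIntegral
  have := IntermediateField.adjoin.finiteDimensional hint
  have := Module.Free.of_divisionRing (IntermediateField.adjoin E {s})
    (IntermediateField.adjoin (IntermediateField.adjoin E {s}) {α})
  rw [Module.finrank_mul_finrank]
  have : FiniteDimensional E (IntermediateField.adjoin (IntermediateField.adjoin E {s}) {α}) :=
    Module.Finite.trans (IntermediateField.adjoin E {s}) _
  have hle : IntermediateField.adjoin E {α} ≤ (IntermediateField.adjoin
      (IntermediateField.adjoin E {s}) {α}).restrictScalars E := by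
    rw [IntermediateField.adjoin_simple_le_iff]
    exact IntermediateField.mem_adjoin_simple_self _ α
  have : FiniteDimensional E ((IntermediateField.adjoin
      (IntermediateField.adjoin E {s}) {α}).restrictScalars E) := this
  exact IntermediateField.finrank_le_of_le_right hle

/-- A finitely generated field of characteristic zero has algebraic numbers of arbitrarily large
degree over it. -/
theorem exists_isAlgebraic_rat_lt_natDegree_minpoly {Ω : Type*} [Field Ω] [IsAlgClosed Ω]
    [CharZero Ω] (S : Set Ω) (hS : S.Finite) (N : ℕ) :
    ∃ α : Ω, IsAlgebraic ℚ α ∧ N < (minpoly (IntermediateField.adjoin ℚ S) α).natDegree := by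
  induction S, hS using Set.Finite.induction_on generalizing N with
  | empty =>
    obtain ⟨p, hNp, hp⟩ := Nat.exists_infinite_primes (N + 2)
    have : NeZero (p : Ω) := ⟨Nat.cast_ne_zero.mpr hp.ne_zero⟩
    obtain ⟨ζ, hζ⟩ := HasEnoughRootsOfUnity.exists_primitiveRoot Ω p
    have hint : IsIntegral ℚ ζ := (hζ.isIntegral hp.pos).tower_top
    refine ⟨ζ, hint.isAlgebraic, ?_⟩
    have h1 : (minpoly ℚ ζ).natDegree = p - 1 := by
      rw [← Polynomial.cyclotomic_eq_minpoly_rat hζ hp.pos, Polynomial.natDegree_cyclotomic,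
        Nat.totient_prime hp]
    have h2 := natDegree_minpoly_le_mul_adjoin (E := ℚ) (s := (0 : Ω)) isAlgebraic_zero
      hint.isAlgebraic
    rw [minpoly.zero, Polynomial.natDegree_X, one_mul] at h2
    have h3 : IntermediateField.adjoin ℚ (∅ : Set Ω) = IntermediateField.adjoin ℚ {(0 : Ω)} := by
      simp
    rw [h3]
    omega
  | @insert s S hs hS ih =>
    have hE := IntermediateField.adjoin_adjoin_left ℚ S {s}
    rw [Set.union_singleton] at hE
    rw [← hE]
    change ∃ α : Ω, IsAlgebraic ℚ α ∧ N < (minpoly (IntermediateField.adjoin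
      (IntermediateField.adjoin ℚ S) {s}) α).natDegree
    by_cases halg : IsAlgebraic (IntermediateField.adjoin ℚ S) s
    · obtain ⟨α, hα, hN⟩ := ih ((minpoly (IntermediateField.adjoin ℚ S) s).natDegree * N)
      refine ⟨α, hα, ?_⟩
      exact lt_of_mul_lt_mul_left
        (hN.trans_le (natDegree_minpoly_le_mul_adjoin halg (hα.tower_top _)))
        (Nat.zero_le _)
    · obtain ⟨α, hα, hN⟩ := ih N
      exact ⟨α, hα, hN.trans_le
        (natDegree_minpoly_le_adjoin_transcendental halg (hα.tower_top _))⟩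

theorem Subring.mem_of_mem_span_int {A : Type*} [CommRing A] {R : Subring A} {T : Set A}
    (hT : T ⊆ R) {x : A} (hx : x ∈ Submodule.span ℤ T) : x ∈ R := by
  induction hx using Submodule.span_induction with
  | mem y hy => exact hT hy
  | zero => exact zero_mem R
  | add y z hy hz ihy ihz => exact add_mem ihy ihz
  | smul n y hy ihy => exact zsmul_mem ihy n

theorem Subring.mem_of_mem_pow {A : Type*} [CommRing A] {R : Subring A} {V : Submodule ℤ A}
    (hV : ∀ x ∈ V, x ∈ R) {n : ℕ} {x : A} (hx : x ∈ V ^ n) : x ∈ R := by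
  induction n generalizing x with
  | zero =>
    rw [pow_zero, Submodule.mem_one] at hx
    obtain ⟨m, rfl⟩ := hx
    exact intCast_mem R m
  | succ n ih =>
    rw [pow_succ] at hx
    induction hx using Submodule.mul_induction_on' with
    | mem_mul_mem x hx y hy => exact mul_mem (ih hx) (hV y hy)
    | add x hx y hy h1 h2 => exact add_mem h1 h2

section Reduction

variable {Ω : Type*} [Field Ω] {k : Type*} [Field k] [Algebra k Ω]
variable {kbar : Type*} [Field kbar] [Algebra k kbar]

/-- `ψ` is defined on the multiplicative group `G` and injective on it. -/
def IsInjOnUnits {B : Subalgebra k Ω} (ψ : ↥B →ₐ[k] kbar) (G : Subgroup Ωˣ) : Prop :=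
  (∀ u ∈ G, (u : Ω) ∈ B) ∧ ∀ u ∈ G, ∀ x : B, (x : Ω) = u → ψ x = 1 → u = 1

/-- `ψ` is defined on the additive group `L` and injective on it. -/
def IsInjOnAdd {B : Subalgebra k Ω} (ψ : ↥B →ₐ[k] kbar) (L : Submodule ℤ Ω) : Prop :=
  (∀ x ∈ L, x ∈ B) ∧ ∀ x : B, (x : Ω) ∈ L → ψ x = 0 → x = 0

variable (k kbar) in
/-- Specializations of `D` which extend to some `k`-subalgebra of `Ω` containing `G` and `L`,
injectively on `G` and on `L`. -/
def goodExt (D : Subalgebra k Ω) (G : Subgroup Ωˣ) (L : Submodule ℤ Ω) :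
    Set (↥D →ₐ[k] kbar) :=
  { φ | ∃ (B : Subalgebra k Ω) (h : D ≤ B) (ψ : ↥B →ₐ[k] kbar),
      ψ.comp (Subalgebra.inclusion h) = φ ∧ IsInjOnUnits ψ G ∧ IsInjOnAdd ψ L }

variable (k kbar) in
/-- Injectivity on the additive group `L` may be replaced by injectivity on `L'`, up to enlarging
the multiplicative group. -/
def Reduces (D : Subalgebra k Ω) (L L' : Submodule ℤ Ω) : Prop :=
  ∀ G : Subgroup Ωˣ, G.FG → ∃ G' : Subgroup Ωˣ, G'.FG ∧
    goodExt k kbar D G' L' ⊆ goodExt k kbar D G L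

theorem Reduces.trans {D : Subalgebra k Ω} {L L' L'' : Submodule ℤ Ω}
    (h : Reduces k kbar D L L') (h' : Reduces k kbar D L' L'') : Reduces k kbar D L L'' := by
  intro G hG
  obtain ⟨G', hG', hs⟩ := h G hG
  obtain ⟨G'', hG'', hs'⟩ := h' G' hG'
  exact ⟨G'', hG'', hs'.trans hs⟩

/-- The multiplicative group generated by the nonzero elements of `T`. -/
def unitsClosure (T : Set Ω) : Subgroup Ωˣ :=
  Subgroup.closure (Units.val ⁻¹' T)

theorem unitsClosure_fg {T : Set Ω} (hT : T.Finite) : (unitsClosure T).FG :=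
  (Subgroup.fg_iff _).mpr ⟨_, rfl, hT.preimage Units.val_injective.injOn⟩

theorem IsInjOnUnits.mono {B : Subalgebra k Ω} {ψ : ↥B →ₐ[k] kbar} {G G' : Subgroup Ωˣ}
    (h : IsInjOnUnits ψ G') (hG : G ≤ G') : IsInjOnUnits ψ G :=
  ⟨fun u hu => h.1 u (hG hu), fun u hu => h.2 u (hG hu)⟩

theorem IsInjOnAdd.mono {B : Subalgebra k Ω} {ψ : ↥B →ₐ[k] kbar} {L L' : Submodule ℤ Ω}
    (h : IsInjOnAdd ψ L') (hL : L ≤ L') : IsInjOnAdd ψ L :=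
  ⟨fun u hu => h.1 u (hL hu), fun x hx => h.2 x (hL hx)⟩

theorem IsInjOnUnits.mem_of_unitsClosure {B : Subalgebra k Ω} {ψ : ↥B →ₐ[k] kbar} {T : Set Ω}
    (h : IsInjOnUnits ψ (unitsClosure T)) {x : Ω} (hx : x ∈ T) : x ∈ B := by
  by_cases h0 : x = 0
  · exact h0 ▸ B.zero_mem
  · exact h.1 (Units.mk0 x h0) (Subgroup.subset_closure hx)

theorem IsInjOnUnits.map_ne_zero {B : Subalgebra k Ω} {ψ : ↥B →ₐ[k] kbar} {T : Set Ω}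
    (h : IsInjOnUnits ψ (unitsClosure T)) (x : B) (hx : (x : Ω) ∈ T) (h0 : x ≠ 0) :
    ψ x ≠ 0 := by
  have h0' : (x : Ω) ≠ 0 := fun e => h0 (Subtype.ext e)
  have hu : Units.mk0 (x : Ω) h0' ∈ unitsClosure T := Subgroup.subset_closure hx
  have hinv := h.1 _ (inv_mem hu)
  have hmul : x * ⟨_, hinv⟩ = 1 := Subtype.ext (by simp [h0'])
  intro hz
  have := congrArg ψ hmul
  simp [hz] at this

/-- A criterion for `Reduces` where the extension of the specialization is not changed. -/
theorem Reduces.of_finite {D : Subalgebra k Ω} {L L' : Submodule ℤ Ω} {T : Set Ω}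
    (hT : T.Finite)
    (H : ∀ (B : Subalgebra k Ω) (ψ : ↥B →ₐ[k] kbar), T ⊆ B →
      (∀ x : B, (x : Ω) ∈ T → x ≠ 0 → ψ x ≠ 0) → IsInjOnAdd ψ L' → IsInjOnAdd ψ L) :
    Reduces k kbar D L L' := by
  rintro G hG
  refine ⟨G ⊔ unitsClosure T, hG.sup (unitsClosure_fg hT), ?_⟩
  rintro φ ⟨B, h, ψ, hφ, hG, hL⟩
  have hT' := hG.mono (le_sup_right (a := G))
  exact ⟨B, h, ψ, hφ, hG.mono le_sup_left,
    H B ψ (fun x hx => hT'.mem_of_unitsClosure hx) hT'.map_ne_zero hL⟩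

/-- Clearing denominators. -/
theorem Reduces.of_mul {D : Subalgebra k Ω} {L L' : Submodule ℤ Ω} (hL : L.FG) {c : Ω}
    (hc : c ≠ 0) (hcL : ∀ x ∈ L, c * x ∈ L') : Reduces k kbar D L L' := by
  obtain ⟨s, rfl⟩ := hL
  refine Reduces.of_finite (T := insert c (s : Set Ω)) (s.finite_toSet.insert c) ?_
  intro B ψ hTB hψ hL'
  have hsB : (s : Set Ω) ⊆ B := (Set.subset_insert _ _).trans hTB
  refine ⟨fun x hx => Subring.mem_of_mem_span_int (R := B.toSubring) hsB hx, fun x hx hx0 => ?_⟩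
  have hcB : c ∈ B := hTB (Set.mem_insert _ _)
  have h1 : (⟨c, hcB⟩ : B) * x = 0 := hL'.2 _ (hcL _ hx) (by simp [hx0])
  have h2 := congrArg Subtype.val h1
  simp [hc] at h2
  exact h2

/-- Norms: an additive group inside a finite extension `E` of `F` may be replaced by one
inside `F`. -/
theorem Reduces.exists_of_finiteDimensional {D : Subalgebra k Ω} {F E : Type*} [Field F] [Field E]
    [Algebra F E] [Algebra F Ω] [Algebra E Ω] [IsScalarTower F E Ω] [FiniteDimensional F E]
    {s : Set E} (hs : s.Finite) :
    ∃ L' : Submodule ℤ Ω, L'.FG ∧ (∀ x ∈ L', x ∈ (algebraMap F Ω).range) ∧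
      Reduces k kbar D (Submodule.span ℤ (algebraMap E Ω '' s)) L' := by
  classical
  let b := Module.finBasis F E
  let ι := Fin (Module.finrank F E)
  let M : E →ₐ[F] Matrix ι ι F := Algebra.leftMulMatrix b
  let T₁ : Set Ω := ⋃ p : ι × ι, (fun x => algebraMap F Ω (M x p.1 p.2)) '' s
  have hT₁ : T₁.Finite := Set.finite_iUnion fun _ => hs.image _
  let T₂ : Set Ω := Set.range fun i => algebraMap E Ω (b i)
  have hT₂ : T₂.Finite := Set.finite_range _
  let V := Submodule.span ℤ T₁
  have hMV : ∀ x ∈ Submodule.span ℤ (algebraMap E Ω '' s), ∃ x' : E, algebraMap E Ω x' = x ∧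
      ∀ i j, algebraMap F Ω (M x' i j) ∈ V := by
    intro x hx
    induction hx using Submodule.span_induction with
    | mem y hy =>
      obtain ⟨y', hy', rfl⟩ := hy
      exact ⟨y', rfl, fun i j => Submodule.subset_span
        (Set.mem_iUnion.mpr ⟨(i, j), y', hy', rfl⟩)⟩
    | zero => exact ⟨0, by simp, by simp⟩
    | add y z hy hz ihy ihz =>
      obtain ⟨y', rfl, h1⟩ := ihy
      obtain ⟨z', rfl, h2⟩ := ihz
      exact ⟨y' + z', by simp, fun i j => by simpa using V.add_mem (h1 i j) (h2 i j)⟩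
    | smul n y hy ihy =>
      obtain ⟨y', rfl, h1⟩ := ihy
      refine ⟨n • y', by simp, fun i j => ?_⟩
      rw [map_zsmul M, Matrix.smul_apply, map_zsmul (algebraMap F Ω)]
      exact V.smul_mem n (h1 i j)
  have hVF : ∀ x ∈ V, x ∈ (algebraMap F Ω).range := by
    refine fun x hx => Subring.mem_of_mem_span_int ?_ hx
    intro x hx
    obtain ⟨p, y, -, rfl⟩ := Set.mem_iUnion.mp hx
    exact ⟨_, rfl⟩
  refine ⟨V ^ Fintype.card ι, (Submodule.fg_span hT₁).pow _,
    fun x hx => Subring.mem_of_mem_pow hVF hx, ?_⟩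
  refine Reduces.of_finite (T := algebraMap E Ω '' s ∪ T₁ ∪ T₂)
    (((hs.image _).union hT₁).union hT₂) ?_
  intro B ψ hTB hψ hL'
  have hsB : algebraMap E Ω '' s ⊆ B := fun x hx => hTB (Or.inl (Or.inl hx))
  have hT₁B : T₁ ⊆ B := fun x hx => hTB (Or.inl (Or.inr hx))
  have hT₂B : T₂ ⊆ B := fun x hx => hTB (Or.inr hx)
  refine ⟨fun x hx => Subring.mem_of_mem_span_int (R := B.toSubring) hsB hx, fun x hx hx0 => ?_⟩
  obtain ⟨x', hx', hMx⟩ := hMV x hx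
  have hMB : ∀ i j, algebraMap F Ω (M x' i j) ∈ B := fun i j =>
    Subring.mem_of_mem_span_int (R := B.toSubring) hT₁B (hMx i j)
  let N : Matrix ι ι B := fun i j => ⟨_, hMB i j⟩
  have hNΩ : (N.det : Ω) = (Matrix.det fun i j => algebraMap F Ω (M x' i j)) :=
    RingHom.map_det B.val.toRingHom N
  have hval : (N.det : Ω) = algebraMap F Ω (M x').det := by
    rw [RingHom.map_det, hNΩ]
    rfl
  let v : ι → B := fun i => ⟨algebraMap E Ω (b i), hT₂B ⟨i, rfl⟩⟩
  have hv : Matrix.vecMul v N = x • v := by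
    ext j
    have h1 := Algebra.leftMulMatrix_mulVec_repr b x' (b j)
    have h2 : x' * b j = ∑ i, M x' i j • b i := by
      conv_lhs => rw [← b.sum_repr (x' * b j), ← h1]
      refine Finset.sum_congr rfl fun i _ => ?_
      congr 1
      simp [Matrix.mulVec, dotProduct, M, Finsupp.single_apply]
    have h3 := congrArg (algebraMap E Ω) h2
    simp only [map_mul, map_sum, Algebra.smul_def, ← IsScalarTower.algebraMap_apply, hx'] at h3
    simp only [Matrix.vecMul, dotProduct, Pi.smul_apply, smul_eq_mul]
    push_cast
    simp only [v, N]
    rw [h3]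
    exact Finset.sum_congr rfl fun i _ => mul_comm _ _
  have hne : Nonempty ι := ⟨⟨0, Module.finrank_pos⟩⟩
  have hdet : ψ N.det = 0 := by
    have e1 : ψ N.det = (ψ.toRingHom.mapMatrix N).det := RingHom.map_det ψ.toRingHom N
    rw [e1]
    refine Matrix.exists_vecMul_eq_zero_iff.mp ⟨fun i => ψ (v i), ?_, ?_⟩
    · obtain ⟨i⟩ := hne
      intro h
      refine hψ (v i) (Or.inr ⟨i, rfl⟩) (fun h0 => b.ne_zero i ?_) (congrFun h i)
      have := congrArg Subtype.val h0
      simpa [v] using this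
    · ext j
      have := congrArg ψ (congrFun hv j)
      simp only [Matrix.vecMul, dotProduct, Pi.smul_apply, smul_eq_mul, map_sum, map_mul, hx0,
        zero_mul] at this
      simpa [Matrix.vecMul, dotProduct] using this
  have hdet0 : N.det = 0 := by
    refine hL'.2 _ ?_ hdet
    rw [hNΩ]
    exact Matrix.det_mem_pow V _ hMx
  have hn : Algebra.norm F x' = 0 := by
    rw [Algebra.norm_eq_matrix_det b]
    rw [hdet0] at hval
    exact (algebraMap F Ω).injective (by simpa using hval.symm)
  have := Algebra.norm_eq_zero_iff.mp hn
  exact Subtype.ext (by simp [← hx', this])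

/-- An additive group algebraic over a field may be replaced by one inside that field. -/
theorem Reduces.exists_of_isAlgebraic {D : Subalgebra k Ω} {L : Submodule ℤ Ω} (hL : L.FG)
    {F : Type*} [Field F] [Algebra F Ω] (hF : ∀ x ∈ L, IsAlgebraic F x) :
    ∃ L' : Submodule ℤ Ω, L'.FG ∧ (∀ x ∈ L', x ∈ (algebraMap F Ω).range) ∧
      Reduces k kbar D L L' := by
  obtain ⟨s, rfl⟩ := hL
  have hs : ∀ x ∈ (s : Set Ω), IsIntegral F x := fun x hx =>
    (hF x (Submodule.subset_span hx)).isIntegral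
  have hfd : FiniteDimensional F (IntermediateField.adjoin F (s : Set Ω)) :=
    IntermediateField.finiteDimensional_adjoin hs
  have h := Reduces.exists_of_finiteDimensional (k := k) (kbar := kbar) (D := D) (F := F)
    (E := IntermediateField.adjoin F (s : Set Ω)) (Ω := Ω)
    (s := Subtype.val ⁻¹' (s : Set Ω)) (s.finite_toSet.preimage Subtype.val_injective.injOn)
  convert h
  ext x
  constructor
  · exact fun hx => ⟨⟨x, IntermediateField.subset_adjoin F _ hx⟩, hx, rfl⟩
  · rintro ⟨y, hy, rfl⟩
    exact hy

end Reduction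

/-- A common denominator for a finitely generated additive subgroup of a field. -/
theorem IntermediateField.exists_forall_mul_mem_adjoin {K Ω : Type*} [Field K] [Field Ω]
    [Algebra K Ω] (S : Set Ω) {L : Submodule ℤ Ω} (hL : L.FG)
    (h : ∀ x ∈ L, x ∈ IntermediateField.adjoin K S) :
    ∃ c : Ω, c ≠ 0 ∧ ∀ x ∈ L, c * x ∈ Algebra.adjoin K S := by
  classical
  obtain ⟨s, rfl⟩ := hL
  replace h : ∀ x ∈ s, x ∈ IntermediateField.adjoin K S := fun x hx =>
    h x (Submodule.subset_span hx)
  have key : ∃ c ∈ Algebra.adjoin K S, c ≠ 0 ∧ ∀ x ∈ s, c * x ∈ Algebra.adjoin K S := by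
    induction s using Finset.induction_on with
    | empty => exact ⟨1, one_mem _, one_ne_zero, by simp⟩
    | insert a s ha ih =>
      obtain ⟨c, hcA, hc0, hc⟩ := ih fun x hx => h x (Finset.mem_insert_of_mem hx)
      obtain ⟨r, hr, q, hq, haq⟩ :=
        IntermediateField.mem_adjoin_iff_div.mp (h a (Finset.mem_insert_self a s))
      by_cases hq0 : q = 0
      · refine ⟨c, hcA, hc0, fun x hx => ?_⟩
        rcases Finset.mem_insert.mp hx with rfl | hx
        · simp [haq, hq0]
        · exact hc x hx
      · refine ⟨c * q, mul_mem hcA hq, mul_ne_zero hc0 hq0, fun x hx => ?_⟩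
        rcases Finset.mem_insert.mp hx with rfl | hx
        · have : c * q * x = c * r := by rw [haq]; field_simp
          rw [this]
          exact mul_mem hcA hr
        · have : c * q * x = q * (c * x) := by ring
          rw [this]
          exact mul_mem hq (hc x hx)
  obtain ⟨c, -, hc0, hc⟩ := key
  refine ⟨c, hc0, fun x hx => ?_⟩
  induction hx using Submodule.span_induction with
  | mem y hy => exact hc y hy
  | zero => simp
  | add y z hy hz ihy ihz => rw [mul_add]; exact add_mem ihy ihz
  | smul n y hy ihy => rw [mul_smul_comm]; exact zsmul_mem ihy n

section Reduction

variable {Ω : Type*} [Field Ω] {k : Type*} [Field k] [Algebra k Ω]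
variable {kbar : Type*} [Field kbar] [Algebra k kbar]

theorem Reduces.exists_of_mem_adjoin {D : Subalgebra k Ω} {K : Type*} [Field K] [Algebra K Ω]
    (S : Set Ω) {L : Submodule ℤ Ω} (hL : L.FG)
    (h : ∀ x ∈ L, x ∈ IntermediateField.adjoin K S) :
    ∃ L' : Submodule ℤ Ω, L'.FG ∧ (∀ x ∈ L', x ∈ Algebra.adjoin K S) ∧
      Reduces k kbar D L L' := by
  obtain ⟨c, hc0, hc⟩ := IntermediateField.exists_forall_mul_mem_adjoin S hL h
  refine ⟨L.map (LinearMap.mulLeft ℤ c), hL.map _, ?_,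
    Reduces.of_mul hL hc0 fun x hx => ⟨x, hx, rfl⟩⟩
  rintro _ ⟨x, hx, rfl⟩
  exact hc x hx

/-- The base case: additive groups which are algebraic over the fraction field of `D`. -/
theorem Reduces.exists_of_isAlgebraic_adjoin {D : Subalgebra k Ω} {L : Submodule ℤ Ω} (hL : L.FG)
    (h : ∀ x ∈ L, IsAlgebraic (IntermediateField.adjoin k (D : Set Ω)) x) :
    ∃ L' : Submodule ℤ Ω, L'.FG ∧ (∀ x ∈ L', x ∈ D) ∧ Reduces k kbar D L L' := by
  obtain ⟨L₁, hL₁, h₁, hr₁⟩ := Reduces.exists_of_isAlgebraic (k := k) (kbar := kbar) (D := D) hL h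
  obtain ⟨L₂, hL₂, h₂, hr₂⟩ := Reduces.exists_of_mem_adjoin (k := k) (kbar := kbar) (D := D)
    (K := k) (D : Set Ω) hL₁ (fun x hx => by
      obtain ⟨y, rfl⟩ := h₁ x hx
      exact y.2)
  rw [Algebra.adjoin_eq] at h₂
  exact ⟨L₂, hL₂, h₂, hr₁.trans hr₂⟩

variable [IsAlgClosed Ω] [CharZero Ω] [IsAlgClosure k kbar]

/-- When `L` lies in `D`, good extendability is a basic open condition. -/
theorem exists_isBasicOpen_subset_goodExt (D : Subalgebra k Ω) {G : Subgroup Ωˣ} (hG : G.FG)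
    {L : Submodule ℤ Ω} (hL : L.FG) (hLD : ∀ x ∈ L, x ∈ D) :
    ∃ U : Set (↥D →ₐ[k] kbar), IsBasicOpen k kbar D U ∧ U ⊆ goodExt k kbar D G L := by
  classical
  refine ⟨⋂ Γ ∈ ({Units.val '' (G : Set Ωˣ), (L : Set Ω)} : Finset (Set Ω)), specB k kbar D Γ,
    ⟨_, by simp, ?_, rfl⟩, ?_⟩
  · intro Γ hΓ
    rcases Finset.mem_insert.mp hΓ with rfl | hΓ
    · exact Or.inr ⟨G, hG, rfl⟩
    · rw [Finset.mem_singleton] at hΓ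
      refine Or.inl ⟨L.toAddSubgroup, ?_, hΓ⟩
      exact (Submodule.fg_iff_addSubgroup_fg L).mp hL
  · intro φ hφ
    simp only [Finset.mem_insert, Finset.mem_singleton, Set.iInter_iInter_eq_or_left,
      Set.iInter_iInter_eq_left, Set.mem_inter_iff] at hφ
    obtain ⟨⟨ψ, hψ, hψφ⟩, ⟨χ, hχ, hχφ⟩⟩ := hφ
    refine ⟨_, le_algAdj k D _, ψ, hψφ, ⟨fun u hu => subset_algAdj k D _ ⟨u, hu, rfl⟩, ?_⟩,
      ⟨fun x hx => le_algAdj k D _ (hLD x hx), ?_⟩⟩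
    · intro u hu x hx hx1
      refine Units.ext (hψ u (1 : Ωˣ) ⟨u, hu, rfl⟩ ⟨1, G.one_mem, rfl⟩ ?_)
      have e1 : (⟨u, subset_algAdj k D _ ⟨u, hu, rfl⟩⟩ :
        algAdj k D (Units.val '' (G : Set Ωˣ))) = x := Subtype.ext hx.symm
      rw [e1, hx1]
      exact (map_one ψ).symm
    · intro x hx hx0
      have hxD := hLD _ hx
      have e1 : ψ x = φ ⟨x, hxD⟩ := by rw [← hψφ]; rfl
      have e2 : χ ⟨x, subset_algAdj k D _ hx⟩ = φ ⟨x, hxD⟩ := by rw [← hχφ]; rfl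
      refine Subtype.ext (hχ x 0 hx L.zero_mem ?_)
      rw [e2, ← e1, hx0]
      exact (map_zero χ).symm

/-- Restrictions of a basic open subset contain a set of the form `goodExt`. -/
theorem exists_goodExt_subset {D Dt : Subalgebra k Ω} (hle : D ≤ Dt)
    (hDt : ∃ s : Finset Ω, Dt = Algebra.adjoin k ((D : Set Ω) ∪ (s : Set Ω)))
    {Ut : Set (↥Dt →ₐ[k] kbar)} (hUt : IsBasicOpen k kbar Dt Ut) :
    ∃ (G : Subgroup Ωˣ) (L : Submodule ℤ Ω), G.FG ∧ L.FG ∧ goodExt k kbar D G L ⊆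
      { χ : ↥D →ₐ[k] kbar | ∃ ψ ∈ Ut, ψ.comp (Subalgebra.inclusion hle) = χ } := by
  classical
  obtain ⟨s, hs⟩ := hDt
  obtain ⟨S, -, hS, rfl⟩ := hUt
  have key : ∃ (G : Subgroup Ωˣ) (L : Submodule ℤ Ω), G.FG ∧ L.FG ∧ ∀ Γ ∈ S,
      ∀ (B : Subalgebra k Ω) (ψ : ↥B →ₐ[k] kbar), IsInjOnUnits ψ G → IsInjOnAdd ψ L →
        Γ ⊆ B ∧ ∀ a b : B, (a : Ω) ∈ Γ → (b : Ω) ∈ Γ → ψ a = ψ b → a = b := by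
    clear hs
    induction S using Finset.induction_on with
    | empty => exact ⟨⊥, ⊥, ⟨∅, by simp⟩, Submodule.fg_bot, by simp⟩
    | insert Γ S hΓ ih =>
      obtain ⟨G, L, hG, hL, h⟩ := ih fun Γ hΓ => hS Γ (Finset.mem_insert_of_mem hΓ)
      rcases hS Γ (Finset.mem_insert_self Γ S) with ⟨H, hH, rfl⟩ | ⟨H, hH, rfl⟩
      · refine ⟨G, L ⊔ AddSubgroup.toIntSubmodule H, hG, hL.sup ?_, fun Γ' hΓ' B ψ h1 h2 => ?_⟩
        · rw [Submodule.fg_iff_addSubgroup_fg]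
          simpa using hH
        rcases Finset.mem_insert.mp hΓ' with rfl | hΓ'
        · have h3 := h2.mono (le_sup_right (a := L))
          refine ⟨h3.1, fun a b ha hb hab => ?_⟩
          refine sub_eq_zero.mp (h3.2 _ (sub_mem ha hb : (a : Ω) - b ∈ H) ?_)
          rw [map_sub, hab, sub_self]
        · exact h Γ' hΓ' B ψ h1 (h2.mono le_sup_left)
      · refine ⟨G ⊔ H, L, hG.sup hH, hL, fun Γ' hΓ' B ψ h1 h2 => ?_⟩
        rcases Finset.mem_insert.mp hΓ' with rfl | hΓ'
        · have h3 := h1.mono (le_sup_right (a := G))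
          refine ⟨by rintro _ ⟨u, hu, rfl⟩; exact h3.1 u hu, ?_⟩
          rintro ⟨_, ha⟩ ⟨_, hb⟩ ⟨u, hu, rfl⟩ ⟨v, hv, rfl⟩ hab
          have hvB := h3.1 _ (inv_mem hv)
          have := h3.2 (u * v⁻¹) (mul_mem hu (inv_mem hv)) (⟨u, ha⟩ * ⟨_, hvB⟩) (by simp) ?_
          · exact Subtype.ext (congrArg Units.val (mul_inv_eq_one.mp this))
          · rw [map_mul, hab, ← map_mul, ← map_one ψ]
            congr 1
            exact Subtype.ext (by simp)
        · exact h Γ' hΓ' B ψ (h1.mono le_sup_left) h2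
  obtain ⟨G, L, hG, hL, h⟩ := key
  refine ⟨G ⊔ unitsClosure s, L, hG.sup (unitsClosure_fg s.finite_toSet), hL, ?_⟩
  rintro φ ⟨B, hDB, ψ, rfl, h1, h2⟩
  have hDtB : Dt ≤ B := by
    rw [hs, Algebra.adjoin_le_iff, Set.union_subset_iff]
    exact ⟨hDB, fun x hx => (h1.mono (le_sup_right (a := G))).mem_of_unitsClosure hx⟩
  refine ⟨ψ.comp (Subalgebra.inclusion hDtB), ?_, rfl⟩
  simp only [Set.mem_iInter]
  intro Γ hΓ
  obtain ⟨hΓB, hinj⟩ := h Γ hΓ B ψ (h1.mono le_sup_left) h2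
  have hle' : algAdj k Dt Γ ≤ B :=
    Algebra.adjoin_le_iff.mpr (Set.union_subset hDtB hΓB)
  refine ⟨ψ.comp (Subalgebra.inclusion hle'), fun a b ha hb hab => ?_, rfl⟩
  exact congrArg Subtype.val (hinj ⟨a, hΓB ha⟩ ⟨b, hΓB hb⟩ ha hb hab)

end Reduction

theorem IntermediateField.isAlgebraic_of_le {F Ω : Type*} [Field F] [Field Ω] [Algebra F Ω]
    {E E' : IntermediateField F Ω} (h : E ≤ E') {x : Ω} (hx : IsAlgebraic E x) :
    IsAlgebraic E' x := by
  let _ := (IntermediateField.inclusion h).toRingHom.toAlgebra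
  have : IsScalarTower E E' Ω := IsScalarTower.of_algebraMap_eq fun _ => rfl
  exact hx.tower_top E'

theorem exists_algHom_apply_eq_of_isAlgebraic_adjoin {K Ω : Type*} [Field K] [Field Ω]
    [IsAlgClosed Ω] [Algebra K Ω] {t t' : Ω} (ht : Transcendental K t) (ht' : Transcendental K t')
    (h : ∀ x : Ω, IsAlgebraic (IntermediateField.adjoin K {t}) x) :
    ∃ θ : Ω →ₐ[K] Ω, θ t = t' := by
  have : Algebra.IsAlgebraic (IntermediateField.adjoin K {t}) Ω := ⟨h⟩
  let f : IntermediateField.adjoin K {t} →ₐ[K] Ω :=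
    (IntermediateField.val _).comp ((RatFunc.algEquivOfTranscendental t ht).symm.trans
      (RatFunc.algEquivOfTranscendental t' ht')).toAlgHom
  obtain ⟨θ, hθ⟩ := IsAlgClosed.surjective_domRestrict_of_isAlgebraic (E := Ω) f
  refine ⟨θ, ?_⟩
  have h1 := DFunLike.congr_fun hθ (IntermediateField.AdjoinSimple.gen K t)
  have h2 : (RatFunc.algEquivOfTranscendental t ht).symm (IntermediateField.AdjoinSimple.gen K t) =
      RatFunc.X := by
    rw [AlgEquiv.symm_apply_eq]
    exact Subtype.ext (by simp)
  have h3 : f (IntermediateField.AdjoinSimple.gen K t) = t' := by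
    simp [f, h2]
  rw [← h3, ← h1]
  rfl

open scoped IntermediateField.algebraAdjoinAdjoin in
/-- Translating a transcendental element by an algebraic one extends to an endomorphism. -/
theorem Transcendental.exists_algHom_apply_eq_add {F Ω : Type*} [Field F] [Field Ω]
    [IsAlgClosed Ω] [Algebra F Ω] {t α : Ω} (ht : Transcendental F t) (hα : IsAlgebraic F α) :
    ∃ θ : Ω →ₐ[F] Ω, θ t = t + α := by
  have hind : AlgebraicIndepOn F id ({t} : Set Ω) := by
    have := algebraicIndependent_unique_type_iff (R := F) (ι := ({t} : Set Ω))
      (x := fun i => id (i : Ω))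
    exact this.mpr ht
  obtain ⟨B, htB, hB⟩ := exists_isTranscendenceBasis_superset hind
  have htB' : t ∈ B := htB rfl
  let K := IntermediateField.adjoin F (B \ {t})
  have hBind : AlgebraicIndepOn F id (insert t (B \ {t})) := by
    rw [Set.insert_sdiff_singleton, Set.insert_eq_of_mem htB']
    exact hB.1
  have htr := ((AlgebraicIndepOn.insert_iff (by simp)).mp hBind).2
  rw [Set.image_id, id] at htr
  have := IsLocalization.isAlgebraic K
    (nonZeroDivisors (Algebra.adjoin F (B \ {t})))
  have htK : Transcendental K t := htr.extendScalars K
  have hαK : IsAlgebraic K α := hα.tower_top K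
  have ht'K : Transcendental K (t + α) := by
    intro h
    apply htK
    have := h.sub hαK
    rwa [add_sub_cancel_right] at this
  obtain ⟨θ, hθ⟩ := exists_algHom_apply_eq_of_isAlgebraic_adjoin htK ht'K (fun x => by
    have := hB.isAlgebraic_field
    have h1 := this.isAlgebraic x
    have hle : IntermediateField.adjoin F (Set.range ((↑) : B → Ω)) ≤
        (IntermediateField.adjoin K {t}).restrictScalars F := by
      rw [IntermediateField.adjoin_le_iff, Subtype.range_coe]
      intro y hy
      by_cases hyt : y = t
      · subst hyt
        exact IntermediateField.mem_adjoin_simple_self K y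
      · have hyK : y ∈ K := IntermediateField.subset_adjoin F _ ⟨hy, hyt⟩
        exact (IntermediateField.adjoin K {t}).algebraMap_mem ⟨y, hyK⟩
    exact IntermediateField.isAlgebraic_of_le hle h1)
  exact ⟨θ.restrictScalars F, hθ⟩

theorem Subgroup.FG.map_monoidHom {G H : Type*} [Group G] [Group H] {K : Subgroup G} (hK : K.FG)
    (f : G →* H) : (K.map f).FG := by
  obtain ⟨S, rfl⟩ := hK
  exact (Subgroup.fg_iff _).mpr
    ⟨f '' S, (MonoidHom.map_closure f _).symm, S.finite_toSet.image _⟩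

section Resultant

open Polynomial

theorem Polynomial.resultant_mem_pow {A : Type*} [CommRing A] {V : Submodule ℤ A}
    {p q : Polynomial A} (hp : ∀ i, p.coeff i ∈ V) (hq : ∀ i, q.coeff i ∈ V) (m n : ℕ) :
    p.resultant q m n ∈ V ^ (m + n) := by
  have h := Matrix.det_mem_pow V (sylvester p q m n) ?_
  · rwa [Fintype.card_fin] at h
  · intro i j
    induction j using Fin.addCases with
    | left j =>
      simp only [sylvester, Matrix.of_apply, Fin.addCases_left]
      split_ifs
      exacts [hq _, V.zero_mem]
    | right j =>
      simp only [sylvester, Matrix.of_apply, Fin.addCases_right]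
      split_ifs
      exacts [hp _, V.zero_mem]

/-- If a specialization kills the values of `p` and `q` at a common point, it kills their
resultant. -/
theorem Polynomial.map_resultant_eq_zero {Ω k kbar : Type*} [Field Ω] [Field k] [Algebra k Ω]
    [Field kbar] [Algebra k kbar] {B : Subalgebra k Ω} (ψ : ↥B →ₐ[k] kbar)
    {p q : Polynomial Ω} (hp : ∀ i, p.coeff i ∈ B) (hq : ∀ i, q.coeff i ∈ B)
    (hdeg : p.natDegree ≠ 0 ∨ q.natDegree ≠ 0) (t : B)
    (hpt : ∀ x : B, (x : Ω) = p.eval (t : Ω) → ψ x = 0)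
    (hqt : ∀ x : B, (x : Ω) = q.eval (t : Ω) → ψ x = 0) :
    ∃ x : B, (x : Ω) = p.resultant q ∧ ψ x = 0 := by
  have lift : ∀ r : Polynomial Ω, (∀ i, r.coeff i ∈ B) → ∃ r' : Polynomial B,
      r'.map (algebraMap B Ω) = r := fun r hr => by
    have hl : r ∈ lifts (algebraMap B Ω) :=
      (lifts_iff_coeff_lifts r).mpr fun i => ⟨⟨_, hr i⟩, rfl⟩
    exact (mem_lifts r).mp hl
  obtain ⟨p', rfl⟩ := lift p hp
  obtain ⟨q', rfl⟩ := lift q hq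
  have hinj : Function.Injective (algebraMap B Ω) := Subtype.val_injective
  rw [natDegree_map_eq_of_injective hinj, natDegree_map_eq_of_injective hinj] at hdeg
  have hev : ∀ r : Polynomial B, ((r.eval t : B) : Ω) = (r.map (algebraMap B Ω)).eval (t : Ω) :=
    fun r => by
      rw [eval_map]
      exact hom_eval₂ r (RingHom.id B) (algebraMap B Ω) t
  obtain ⟨a, b, -, -, hab⟩ := exists_mul_add_mul_eq_C_resultant p' q' le_rfl le_rfl hdeg
  refine ⟨resultant p' q', ?_, ?_⟩
  · rw [natDegree_map_eq_of_injective hinj, natDegree_map_eq_of_injective hinj,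
      resultant_map_map]
    rfl
  · have h := congrArg (fun r => ψ (eval t r)) hab
    simp only [eval_add, eval_mul, eval_C, map_add, map_mul, hpt _ (hev p'), hqt _ (hev q')] at h
    simpa using h.symm

end Resultant

open Polynomial in
/-- Additive groups of polynomials in a transcendental element `t` over `F`, which is moved by a
translation, may be replaced by ones algebraic over `F`. -/
theorem Reduces.exists_of_transcendental {Ω : Type*} [Field Ω] [IsAlgClosed Ω] [CharZero Ω]
    {k kbar : Type*} [Field k] [Algebra k Ω] [Field kbar] [Algebra k kbar]
    {D : Subalgebra k Ω} {F : IntermediateField k Ω} (hDF : ∀ x ∈ D, x ∈ F)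
    {t : Ω} (ht : Transcendental F t) {L : Submodule ℤ Ω} (hL : L.FG)
    (h : ∀ x ∈ L, x ∈ Algebra.adjoin F {t}) :
    ∃ L' : Submodule ℤ Ω, L'.FG ∧ (∀ x ∈ L', IsAlgebraic F x) ∧ Reduces k kbar D L L' := by
  classical
  obtain ⟨s, rfl⟩ := hL
  have hs : ∀ x ∈ s, ∃ p : Polynomial F, aeval t p = x := fun x hx => by
    have := h x (Submodule.subset_span hx)
    rwa [Algebra.adjoin_singleton_eq_range_aeval] at this
  choose! P hP using hs
  let S : Finset Ω := insert 1 (s.biUnion fun x =>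
    (P x).support.image fun i => (((P x).coeff i : F) : Ω))
  let d := s.sup (fun x => (P x).natDegree) + 1
  let T := Submodule.span ℤ (S : Set Ω)
  have hTF : ∀ x ∈ T, x ∈ F := by
    refine fun x hx => Subring.mem_of_mem_span_int (R := F.toSubalgebra.toSubring) ?_ hx
    intro y hy
    rcases Finset.mem_insert.mp hy with rfl | hy
    · exact F.one_mem
    · obtain ⟨x, hx, hy⟩ := Finset.mem_biUnion.mp hy
      obtain ⟨i, hi, rfl⟩ := Finset.mem_image.mp hy
      exact Subtype.prop _
  have hL : ∀ x ∈ Submodule.span ℤ (s : Set Ω), ∃ p : Polynomial Ω, p.eval t = x ∧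
      p.natDegree ≤ d ∧ ∀ i, p.coeff i ∈ T := by
    intro x hx
    induction hx using Submodule.span_induction with
    | mem y hy =>
      refine ⟨(P y).map (algebraMap F Ω), ?_, ?_, fun i => ?_⟩
      · rw [eval_map_algebraMap, hP y hy]
      · exact natDegree_map_le.trans
          ((Finset.le_sup (f := fun x => (P x).natDegree) hy).trans (Nat.le_succ _))
      · rw [coeff_map]
        by_cases hi : (P y).coeff i = 0
        · rw [hi, map_zero]; exact T.zero_mem
        · exact Submodule.subset_span (Finset.mem_insert_of_mem (Finset.mem_biUnion.mpr
            ⟨y, hy, Finset.mem_image.mpr ⟨i, mem_support_iff.mpr hi, rfl⟩⟩))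
    | zero => exact ⟨0, by simp, by simp, by simp⟩
    | add y z hy hz ihy ihz =>
      obtain ⟨p, rfl, h1, h2⟩ := ihy
      obtain ⟨q, rfl, h3, h4⟩ := ihz
      refine ⟨p + q, by simp, natDegree_add_le_of_degree_le h1 h3, fun i => ?_⟩
      rw [coeff_add]
      exact T.add_mem (h2 i) (h4 i)
    | smul n y hy ihy =>
      obtain ⟨p, rfl, h1, h2⟩ := ihy
      refine ⟨n • p, ?_, (natDegree_smul_le n p).trans h1, fun i => ?_⟩
      · rw [eval_smul]
      · rw [coeff_smul]
        exact T.smul_mem n (h2 i)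
  obtain ⟨α, hα, hdα⟩ := exists_isAlgebraic_rat_lt_natDegree_minpoly (S : Set Ω) S.finite_toSet
    (d * d)
  have hαF : IsAlgebraic F α := hα.tower_top F
  let S' : Set Ω := Set.image2 (fun c i => c * α ^ i) (S : Set Ω) (Set.Iic d)
  have hS' : S'.Finite := S.finite_toSet.image2 _ (Set.finite_Iic d)
  let W := Submodule.span ℤ S'
  have hTW : T ≤ W := Submodule.span_mono fun c hc => ⟨c, hc, 0, Nat.zero_le _, by simp⟩
  have h1W : 1 ≤ W := Submodule.one_le.mpr
    (hTW (Submodule.subset_span (Finset.mem_insert_self _ _)))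
  have hWpow : ∀ {m n : ℕ}, m ≤ n → W ^ m ≤ W ^ n := fun h => pow_le_pow_right' h1W h
  have hWalg : ∀ x ∈ W, IsAlgebraic F x := by
    refine fun x hx => Subring.mem_of_mem_span_int
      (R := (Subalgebra.algebraicClosure F Ω).toSubring) ?_ hx
    rintro _ ⟨c, hc, i, -, rfl⟩
    have hcF : c ∈ F := hTF c (Submodule.subset_span hc)
    exact (isAlgebraic_algebraMap (⟨c, hcF⟩ : F)).mul (hαF.pow i)
  have hTα : ∀ c ∈ T, ∀ i ≤ d, c * α ^ i ∈ W := by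
    intro c hc i hi
    induction hc using Submodule.span_induction with
    | mem y hy => exact Submodule.subset_span ⟨y, hy, i, hi, rfl⟩
    | zero => simp
    | add y z hy hz ihy ihz => rw [add_mul]; exact W.add_mem ihy ihz
    | smul n y hy ihy => rw [smul_mul_assoc]; exact W.smul_mem n ihy
  have htaylor : ∀ q : Polynomial Ω, q.natDegree ≤ d → (∀ i, q.coeff i ∈ T) →
      ∀ i, (q.comp (X + C α)).coeff i ∈ W := by
    intro q hqd hq i
    rw [← taylor_apply, taylor_coeff, hasseDeriv_apply, sum_def, eval_finsetSum]
    refine W.sum_mem fun j hj => ?_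
    rw [eval_monomial, mul_assoc, ← nsmul_eq_mul]
    exact W.nsmul_mem (hTα _ (hq j) _ ((Nat.sub_le _ _).trans
      ((le_natDegree_of_mem_supp j hj).trans hqd))) _
  obtain ⟨θ, hθ⟩ := ht.exists_algHom_apply_eq_add hαF
  have hθF : ∀ x ∈ F, θ x = x := fun x hx => θ.commutes ⟨x, hx⟩
  have hθeval : ∀ q : Polynomial Ω, (∀ i, q.coeff i ∈ T) →
      θ (q.eval t) = (q.comp (X + C α)).eval t := by
    intro q hq
    rw [eval_comp, eval_add, eval_X, eval_C, ← hθ, eval_eq_sum, eval_eq_sum, sum_def, sum_def,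
      map_sum]
    refine Finset.sum_congr rfl fun i _ => ?_
    rw [map_mul, map_pow, hθF _ (hTF _ (hq i))]
  let θk : Ω →ₐ[k] Ω := θ.restrictScalars k
  refine ⟨W ^ (d + d), (Submodule.fg_span hS').pow _, fun x hx => Subring.mem_of_mem_pow
    (R := (Subalgebra.algebraicClosure F Ω).toSubring) hWalg hx, fun G hG => ?_⟩
  refine ⟨G ⊔ G.map (Units.map (θ : Ω →* Ω)) ⊔ unitsClosure {t},
    (hG.sup (hG.map_monoidHom _)).sup (unitsClosure_fg (Set.finite_singleton t)), ?_⟩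
  rintro φ ⟨B, hDB, ψ, rfl, hG', hL'⟩
  have hGθ := (hG'.mono le_sup_left).mono (le_sup_right (a := G))
  have htB : t ∈ B := (hG'.mono (le_sup_right (b := unitsClosure {t}))).mem_of_unitsClosure rfl
  have hWL' : W ≤ W ^ (d + d) := by
    simpa using hWpow (show 1 ≤ d + d by omega)
  have hWB : ∀ x ∈ W, x ∈ B := fun x hx => hL'.1 x (hWL' hx)
  have hevB : ∀ q : Polynomial Ω, (∀ i, q.coeff i ∈ W) → q.eval t ∈ B := by
    intro q hq
    rw [eval_eq_sum, sum_def]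
    exact sum_mem fun i _ => mul_mem (hWB _ (hq i)) (pow_mem htB i)
  by_cases hgood : IsInjOnAdd ψ (Submodule.span ℤ (s : Set Ω))
  · exact ⟨B, hDB, ψ, rfl, (hG'.mono le_sup_left).mono le_sup_left, hgood⟩
  have hLB : ∀ x ∈ Submodule.span ℤ (s : Set Ω), x ∈ B := by
    intro x hx
    obtain ⟨p, rfl, -, hp⟩ := hL x hx
    exact hevB p fun i => hTW (hp i)
  obtain ⟨x, hxL, hx0, hxne⟩ : ∃ x : B, (x : Ω) ∈ Submodule.span ℤ (s : Set Ω) ∧ ψ x = 0 ∧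
      x ≠ 0 := by
    by_contra! hcon
    exact hgood ⟨hLB, hcon⟩
  obtain ⟨p, hpx, hpd, hpT⟩ := hL x hxL
  have hp0 : p ≠ 0 := by
    rintro rfl
    exact hxne (Subtype.ext (by simpa using hpx.symm))
  have hDB' : D ≤ B.comap θk := fun y hy => by
    change θ y ∈ B
    rw [hθF y (hDF y hy)]
    exact hDB hy
  refine ⟨B.comap θk, hDB', ψ.comp ((θk.comp (B.comap θk).val).codRestrict B fun y => y.2),
    ?_, ⟨fun u hu => ?_, fun u hu y hy hy1 => ?_⟩, ⟨fun y hy => ?_, fun y hy hy0 => ?_⟩⟩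
  · ext y
    refine congrArg ψ (Subtype.ext ?_)
    exact hθF y (hDF y y.2)
  · exact hGθ.1 _ ⟨u, hu, rfl⟩
  · have := hGθ.2 _ ⟨u, hu, rfl⟩ ⟨θ y, y.2⟩ (by simp [hy]) hy1
    refine Units.ext (θ.injective ?_)
    simpa using congrArg Units.val this
  · obtain ⟨q, rfl, hqd, hqT⟩ := hL y hy
    change θ _ ∈ B
    rw [hθeval q hqT]
    exact hevB _ (htaylor q hqd hqT)
  · obtain ⟨q, hqy, hqd, hqT⟩ := hL y hy
    by_contra hyne
    have hq0 : q ≠ 0 := by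
      rintro rfl
      exact hyne (Subtype.ext (by simpa using hqy.symm))
    have hSE : ∀ c ∈ T, c ∈ IntermediateField.adjoin ℚ (S : Set Ω) := fun c hc =>
      Subring.mem_of_mem_span_int
        (R := (IntermediateField.adjoin ℚ (S : Set Ω)).toSubalgebra.toSubring)
        (IntermediateField.subset_adjoin ℚ _) hc
    have hcop := isCoprime_comp_X_add_C_of_lt_natDegree_minpoly _ hdα hp0 hq0 hpd hqd
      (fun i => hSE _ (hpT i)) (fun i => hSE _ (hqT i))
    have hres := resultant_ne_zero _ _ hcop
    have hdegq : (q.comp (X + C α)).natDegree = q.natDegree := by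
      rw [← taylor_apply, natDegree_taylor]
    have hdeg : p.natDegree ≠ 0 ∨ (q.comp (X + C α)).natDegree ≠ 0 := by
      by_contra! hcon
      rw [eq_C_of_natDegree_eq_zero hcon.1, eval_C] at hpx
      exact hxne (hL'.2 x (hWL' (hTW (hpx ▸ hpT 0))) hx0)
    obtain ⟨r, hr, hr0⟩ := map_resultant_eq_zero ψ (fun i => hWB _ (hTW (hpT i)))
      (fun i => hWB _ (htaylor q hqd hqT i)) hdeg ⟨t, htB⟩
      (fun z hz => by rwa [Subtype.ext (hz.trans hpx)])
      (fun z hz => by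
        rw [← hy0]
        refine congrArg ψ (Subtype.ext (hz.trans ?_))
        rw [← hθeval q hqT, hqy]
        rfl)
    refine hres ?_
    rw [← hr, hL'.2 r ?_ hr0]
    · rfl
    · rw [hr]
      refine hWpow ?_ (resultant_mem_pow (fun i => hTW (hpT i)) (htaylor q hqd hqT) _ _)
      rw [hdegq]
      exact Nat.add_le_add hpd hqd

/-- Every finitely generated additive group may be replaced by one inside `D`. -/
theorem Reduces.exists_le {Ω : Type*} [Field Ω] [IsAlgClosed Ω] [CharZero Ω]
    {k kbar : Type*} [Field k] [Algebra k Ω] [Field kbar] [Algebra k kbar]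
    {D : Subalgebra k Ω} {L : Submodule ℤ Ω} (hL : L.FG) :
    ∃ L' : Submodule ℤ Ω, L'.FG ∧ (∀ x ∈ L', x ∈ D) ∧ Reduces k kbar D L L' := by
  classical
  have key : ∀ s : Finset Ω, ∃ F : IntermediateField k Ω, (∀ x ∈ D, x ∈ F) ∧ (∀ x ∈ s, x ∈ F) ∧
      ∀ L : Submodule ℤ Ω, L.FG → (∀ x ∈ L, IsAlgebraic F x) →
        ∃ L' : Submodule ℤ Ω, L'.FG ∧ (∀ x ∈ L', x ∈ D) ∧ Reduces k kbar D L L' := by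
    intro s
    induction s using Finset.induction_on with
    | empty =>
      exact ⟨IntermediateField.adjoin k (D : Set Ω), IntermediateField.subset_adjoin k _,
        by simp, fun L hL h => Reduces.exists_of_isAlgebraic_adjoin hL h⟩
    | insert t s hts ih =>
      obtain ⟨F, hDF, hsF, hF⟩ := ih
      have hle : ∀ x ∈ F, x ∈ IntermediateField.adjoin F {t} := fun x hx =>
        (IntermediateField.adjoin F {t}).algebraMap_mem ⟨x, hx⟩
      refine ⟨(IntermediateField.adjoin F {t}).restrictScalars k, fun x hx => hle x (hDF x hx),
        fun x hx => ?_, fun L hL h => ?_⟩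
      · rcases Finset.mem_insert.mp hx with rfl | hx
        · exact IntermediateField.mem_adjoin_simple_self F x
        · exact hle x (hsF x hx)
      replace h : ∀ x ∈ L, IsAlgebraic (IntermediateField.adjoin F {t}) x := h
      by_cases ht : IsAlgebraic F t
      · have := IntermediateField.isAlgebraic_adjoin_simple ht.isIntegral
        exact hF L hL fun x hx => (h x hx).restrictScalars F
      · obtain ⟨L₁, hL₁, h₁, hr₁⟩ :=
          Reduces.exists_of_isAlgebraic (k := k) (kbar := kbar) (D := D) hL h
        obtain ⟨L₂, hL₂, h₂, hr₂⟩ := Reduces.exists_of_mem_adjoin (k := k) (kbar := kbar) (D := D)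
          (K := F) {t} hL₁ (fun x hx => by
            obtain ⟨y, rfl⟩ := h₁ x hx
            exact y.2)
        obtain ⟨L₃, hL₃, h₃, hr₃⟩ :=
          Reduces.exists_of_transcendental (kbar := kbar) hDF ht hL₂ h₂
        obtain ⟨L₄, hL₄, h₄, hr₄⟩ := hF L₃ hL₃ h₃
        exact ⟨L₄, hL₄, h₄, ((hr₁.trans hr₂).trans hr₃).trans hr₄⟩
  obtain ⟨s, rfl⟩ := hL
  obtain ⟨F, -, hsF, hF⟩ := key s
  refine hF _ ⟨s, rfl⟩ fun x hx => ?_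
  have hxF : x ∈ F := Subring.mem_of_mem_span_int (R := F.toSubalgebra.toSubring) hsF hx
  exact isAlgebraic_algebraMap (⟨x, hxF⟩ : F)

/-- Lemma 2.1 of the paper. If `D̃` is a finitely generated `D`-algebra with
`D ⊆ D̃ ⊆ Ω` and `Ũ` is a basic open subset of `Hom_k(D̃,k̄)`, then the set of restrictions to `D`
of the elements of `Ũ` contains a basic open subset of `Hom_k(D,k̄)`. -/
theorem restriction_contains_basic_open
    {Ω : Type*} [Field Ω] [IsAlgClosed Ω] [CharZero Ω]
    (k : Type*) [Field k] [Algebra k Ω]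
    (kbar : Type*) [Field kbar] [Algebra k kbar] [IsAlgClosure k kbar]
    (D Dt : Subalgebra k Ω) (hD : D.FG) (hle : D ≤ Dt)
    (hDt : ∃ s : Finset Ω, Dt = Algebra.adjoin k ((D : Set Ω) ∪ (s : Set Ω)))
    (Ut : Set (↥Dt →ₐ[k] kbar)) (hUt : IsBasicOpen k kbar Dt Ut) :
    ∃ U : Set (↥D →ₐ[k] kbar), IsBasicOpen k kbar D U ∧
      U ⊆ { χ : ↥D →ₐ[k] kbar | ∃ ψ ∈ Ut, ψ.comp (Subalgebra.inclusion hle) = χ } := by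
  obtain ⟨G, L, hG, hL, h₁⟩ := exists_goodExt_subset hle hDt hUt
  obtain ⟨L', hL', hLD, hred⟩ := Reduces.exists_le (k := k) (kbar := kbar) (D := D) hL
  obtain ⟨G', hG', h₂⟩ := hred G hG
  obtain ⟨U, hU, h₃⟩ := exists_isBasicOpen_subset_goodExt (kbar := kbar) D hG' hL' hLD
  exact ⟨U, hU, (h₃.trans h₂).trans h₁⟩
end

section
/- Assume hypothesis (H) and that k is hilbertian. Then for every positive integer d, every finite set 𝐟 of irreducible polynomials in k[z,y] ∖ k[z], and every nonzero g ∈ k[z], the set ℋ_D(d,𝐟,g) is nonempty. -/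
set_option linter.unusedSectionVars false
set_option linter.unusedVariables false

set_option linter.unusedSectionVars false
set_option linter.unusedVariables false

/-- A field `k`, with algebraic closure `k̄`, is *hilbertian* if: for every finite extension
`k̃` of `k` inside `k̄`, every `m ≥ 1`, every finite set of polynomials
`f ∈ k[t₁,…,t_m][y]`, each of positive degree in `y` and irreducible over `k̃(t₁,…,t_m)`,
and every nonzero `g ∈ k[t₁,…,t_m]`, there is `c ∈ k^m` with `g(c) ≠ 0` such that each
`f(c,y)` is irreducible in `k̃[y]`. -/
def IsHilbertian (k kbar : Type*) [Field k] [Field kbar] [Algebra k kbar] : Prop :=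
  ∀ kt : IntermediateField k kbar, FiniteDimensional k kt →
  ∀ m : ℕ, 0 < m →
  ∀ fs : Finset (Polynomial (MvPolynomial (Fin m) k)),
    (∀ f ∈ fs, 0 < f.natDegree ∧
      Irreducible (f.map ((algebraMap (MvPolynomial (Fin m) kt)
          (FractionRing (MvPolynomial (Fin m) kt))).comp
        (MvPolynomial.map (algebraMap k kt))))) →
  ∀ g : MvPolynomial (Fin m) k, g ≠ 0 →
    ∃ c : Fin m → k, MvPolynomial.eval c g ≠ 0 ∧
      ∀ f ∈ fs, Irreducible (f.map ((algebraMap k kt).comp (MvPolynomial.eval c)))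

section HypH

variable {Ω : Type*} [Field Ω] [IsAlgClosed Ω] [CharZero Ω]
variable (k : Type*) [Field k] [Algebra k Ω]
variable (kbar : Type*) [Field kbar] [Algebra k kbar] [IsAlgClosure k kbar]
variable {m : ℕ} (z : Fin m → Ω) (δ : MvPolynomial (Fin m) k) (η : Ω)

/-- The algebra `D = k[z, 1/δ(z), η]` of hypothesis (H). -/
noncomputable def Dalg : Subalgebra k Ω :=
  Algebra.adjoin k (Set.range z ∪ {(MvPolynomial.aeval z δ)⁻¹, η})

theorem z_mem (i : Fin m) : z i ∈ Dalg k z δ η :=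
  Algebra.subset_adjoin (Set.mem_union_left _ ⟨i, rfl⟩)

theorem aeval_mem (g : MvPolynomial (Fin m) k) :
    MvPolynomial.aeval z g ∈ Dalg k z δ η := by
  have h : MvPolynomial.aeval z g ∈ Algebra.adjoin k (Set.range z) := by
    rw [Algebra.adjoin_range_eq_range_aeval]
    exact ⟨g, rfl⟩
  exact Algebra.adjoin_mono Set.subset_union_left h

/-- For `φ ∈ Hom_k(D,k̄)`, the polynomial `f(φ(z₁),…,φ(z_m),y)` with coefficients in the
subfield `k(φ(z₁),…,φ(z_m))` of `k̄`, obtained from `f ∈ k[z₁,…,z_m][y]`. -/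
noncomputable def specPoly (φ : ↥(Dalg k z δ η) →ₐ[k] kbar)
    (f : Polynomial (MvPolynomial (Fin m) k)) :
    Polynomial ↥(IntermediateField.adjoin k
      (Set.range fun i => φ ⟨z i, z_mem k z δ η i⟩)) :=
  f.map (MvPolynomial.aeval fun i =>
    (⟨φ ⟨z i, z_mem k z δ η i⟩,
      IntermediateField.subset_adjoin k _ ⟨i, rfl⟩⟩ :
      ↥(IntermediateField.adjoin k
        (Set.range fun i => φ ⟨z i, z_mem k z δ η i⟩)))).toRingHom

/-- The set `ℋ_D(d,𝐟,g)` of specializations. -/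
noncomputable def Hset (d : ℕ) (fs : Finset (Polynomial (MvPolynomial (Fin m) k)))
    (g : MvPolynomial (Fin m) k) : Set (↥(Dalg k z δ η) →ₐ[k] kbar) :=
  { φ | φ ⟨MvPolynomial.aeval z g, aeval_mem k z δ η g⟩ ≠ 0 ∧
    (∀ i : Fin m, Module.finrank k
      ↥(IntermediateField.adjoin k
        ((fun j => φ ⟨z j, z_mem k z δ η j⟩) '' { j : Fin m | j ≤ i })) = d ^ ((i : ℕ) + 1)) ∧
    ∀ f ∈ fs, 0 < (specPoly k kbar z δ η φ f).natDegree ∧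
      Irreducible (specPoly k kbar z δ η φ f) }

end HypH

open Polynomial

theorem Irreducible.map_fractionRing {A : Type*} [CommRing A] [IsDomain A]
    [UniqueFactorizationMonoid A] {p : A[X]} (hp : Irreducible p) (h0 : p.natDegree ≠ 0) :
    Irreducible (p.map (algebraMap A (FractionRing A))) :=
  ((hp.isPrimitive h0).irreducible_iff_irreducible_map_fraction_map).1 hp

theorem exists_irreducible_aeval_eq_zero {ι A S : Type*} [Fintype ι]
    [CommRing A] [IsDomain A] [UniqueFactorizationMonoid A] [CharZero A]
    [CommRing S] [IsDomain S] [Algebra A S] [FaithfulSMul A S] [Algebra.EssFiniteType A S]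
    [Algebra.IsAlgebraic A S] {v : ι → S} (hv : LinearIndependent A v) :
    ∃ (θ : S) (P : A[X]), Irreducible P ∧ 0 < P.natDegree ∧ Fintype.card ι ≤ P.natDegree ∧
      aeval θ P = 0 := by
  classical
  let K := FractionRing A
  let L := FractionRing S
  let : Algebra K L := FractionRing.liftAlgebra A L
  have : IsScalarTower A K L := FractionRing.isScalarTower_liftAlgebra A L
  have : CharZero K := IsFractionRing.charZero A
  have : Algebra.IsAlgebraic A L := (IsFractionRing.isAlgebraic_iff' A S L).1 inferInstance
  have : Algebra.IsAlgebraic K L :=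
    ⟨fun x ↦ (IsFractionRing.isAlgebraic_iff A K L).1 (Algebra.IsAlgebraic.isAlgebraic x)⟩
  have : Algebra.EssFiniteType S L := .of_isLocalization L (nonZeroDivisors S)
  have : Algebra.EssFiniteType A L := .comp A S L
  have : Algebra.EssFiniteType K L := .of_comp A K L
  have : Module.Finite K L := Algebra.finite_of_essFiniteType_of_isAlgebraic
  obtain ⟨x, hx⟩ := Field.exists_primitive_element K L
  obtain ⟨a, b, hb, rfl⟩ := IsFractionRing.div_surjective (A := S) x
  obtain ⟨θ, r, hr, hθ⟩ := Algebra.IsAlgebraic.exists_smul_eq_mul A a (nonZeroDivisors.ne_zero hb)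
  have hr' : algebraMap A L r ≠ 0 := by
    rw [IsScalarTower.algebraMap_apply A S L]
    simpa using hr
  have hb' : algebraMap S L b ≠ 0 := by simpa using nonZeroDivisors.ne_zero hb
  have hmem : algebraMap S L a / algebraMap S L b ∈ IntermediateField.adjoin K {algebraMap S L θ} := by
    have h1 := congrArg (algebraMap S L) hθ
    rw [Algebra.smul_def, map_mul, map_mul, ← IsScalarTower.algebraMap_apply A S L] at h1
    have : algebraMap S L a / algebraMap S L b =
        algebraMap S L θ / algebraMap K L (algebraMap A K r) := by
      rw [← IsScalarTower.algebraMap_apply A K L]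
      rw [div_eq_div_iff hb' hr']
      linear_combination h1
    rw [this]
    exact div_mem (IntermediateField.mem_adjoin_simple_self K _) (IntermediateField.algebraMap_mem _ _)
  have htop : IntermediateField.adjoin K {algebraMap S L θ} = ⊤ := by
    rw [eq_top_iff, ← hx, IntermediateField.adjoin_simple_le_iff]
    exact hmem
  have hint : IsIntegral K (algebraMap S L θ) := Algebra.IsIntegral.isIntegral _
  have hdeg : (minpoly K (algebraMap S L θ)).natDegree = Module.finrank K L :=
    (Field.primitive_element_iff_minpoly_natDegree_eq K _).1 htop
  have hcard : Fintype.card ι ≤ Module.finrank K L := by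
    have h1 : LinearIndependent A (algebraMap S L ∘ v) :=
      hv.map_injOn (IsScalarTower.toAlgHom A S L).toLinearMap
        (IsFractionRing.injective S L).injOn
    exact ((LinearIndependent.iff_fractionRing A K).1 h1).fintype_card_le_finrank
  obtain ⟨p, hp0, hp⟩ := Algebra.IsAlgebraic.isAlgebraic (R := A) θ
  have hfac : ∃ P : A[X], Irreducible P ∧ aeval θ P = 0 := by
    have hprod := UniqueFactorizationMonoid.factors_prod hp0
    have h0 : (aeval θ) (UniqueFactorizationMonoid.factors p).prod = 0 := by
      obtain ⟨u, hu⟩ := hprod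
      have := congrArg (aeval θ) hu
      rw [map_mul, hp] at this
      exact (mul_eq_zero.1 this).resolve_right ((u.isUnit.map (aeval θ)).ne_zero)
    rw [map_multiset_prod, Multiset.prod_eq_zero_iff, Multiset.mem_map] at h0
    obtain ⟨q, hq, hq0⟩ := h0
    exact ⟨q, UniqueFactorizationMonoid.irreducible_of_factor q hq, hq0⟩
  obtain ⟨P, hP, hPθ⟩ := hfac
  have hPdeg : P.natDegree ≠ 0 := by
    intro h
    obtain ⟨c, rfl⟩ := natDegree_eq_zero.1 h
    rw [aeval_C, FaithfulSMul.algebraMap_eq_zero_iff] at hPθ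
    exact hP.ne_zero (by rw [hPθ, C_0])
  have hPK : Irreducible (P.map (algebraMap A K)) :=
    hP.map_fractionRing hPdeg
  have hroot : aeval (algebraMap S L θ) (P.map (algebraMap A K)) = 0 := by
    rw [aeval_map_algebraMap, aeval_algebraMap_apply, hPθ, map_zero]
  refine ⟨θ, P, hP, Nat.pos_of_ne_zero hPdeg, ?_, hPθ⟩
  have h2 := natDegree_le_of_dvd (minpoly.dvd _ _ hroot) hPK.ne_zero
  rw [natDegree_map_eq_of_injective (IsFractionRing.injective A K)] at h2
  omega

theorem exists_irreducible_dvd_eval₂ {ι A B : Type*} [Fintype ι]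
    [CommRing A] [IsDomain A] [UniqueFactorizationMonoid A] [CharZero A]
    [CommRing B] [IsDomain B] [UniqueFactorizationMonoid B] (i : A →+* B)
    (hinj : Function.Injective i) (hint : i.IsIntegral) (hfin : i.FiniteType) {b : ι → B}
    (hb : ∀ c : ι → A, ∑ j, i (c j) * b j = 0 → ∀ j, c j = 0)
    {f : B[X]} (hf : Irreducible f) (hf0 : 0 < f.natDegree) :
    ∃ (Θ : B[X]) (P : A[X]), Irreducible P ∧ 0 < P.natDegree ∧
      Fintype.card ι * f.natDegree ≤ P.natDegree ∧ f ∣ eval₂ (C.comp i) Θ P := by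
  classical
  let : Algebra A B := i.toAlgebra
  have : Algebra.FiniteType A B := hfin
  have : Algebra.IsIntegral A B := ⟨hint⟩
  have hprime : Prime f := hf.prime
  have : IsDomain (AdjoinRoot f) := AdjoinRoot.isDomain_of_prime hprime
  have hdvd : ∀ c : B, f ∣ C c → c = 0 := by
    intro c hc
    by_contra h
    have := natDegree_le_of_dvd hc (by simpa using h)
    rw [natDegree_C] at this
    omega
  have hBinj : Function.Injective (algebraMap B (AdjoinRoot f)) := by
    rw [injective_iff_map_eq_zero]
    intro c hc
    exact hdvd c (AdjoinRoot.mk_eq_zero.1 hc)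
  have : FaithfulSMul B (AdjoinRoot f) := (faithfulSMul_iff_algebraMap_injective _ _).2 hBinj
  have : FaithfulSMul A B := (faithfulSMul_iff_algebraMap_injective _ _).2 hinj
  have : FaithfulSMul A (AdjoinRoot f) := .trans A B _
  have : Algebra.IsAlgebraic B (AdjoinRoot f) := by
    have h := (Algebra.isAlgebraic_adjoin_singleton_iff (R := B)).2
      (AdjoinRoot.isAlgebraic_root hf.ne_zero)
    rw [AdjoinRoot.adjoinRoot_eq_top] at h
    exact Algebra.isAlgebraic_iff.2 h
  have : Algebra.IsAlgebraic A (AdjoinRoot f) := .trans A B _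
  have : Algebra.FiniteType B (AdjoinRoot f) := inferInstance
  have : Algebra.FiniteType A (AdjoinRoot f) := .trans (S := B) inferInstance inferInstance
  have hb' : LinearIndependent A b := by
    rw [Fintype.linearIndependent_iff]
    intro c hc
    refine hb c ?_
    simpa [Algebra.smul_def] using! hc
  have hpow : LinearIndependent B fun j : Fin f.natDegree ↦ AdjoinRoot.root f ^ (j : ℕ) := by
    rw [Fintype.linearIndependent_iff]
    intro c hc
    have h1 : f ∣ ∑ j : Fin f.natDegree, C (c j) * X ^ (j : ℕ) := by
      rw [← AdjoinRoot.mk_eq_zero, map_sum, ← hc]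
      refine Finset.sum_congr rfl fun j _ ↦ ?_
      rw [map_mul, map_pow, AdjoinRoot.mk_X, AdjoinRoot.mk_C, Algebra.smul_def]
      rfl
    have h2 : ∑ j : Fin f.natDegree, C (c j) * X ^ (j : ℕ) = 0 := by
      refine eq_zero_of_dvd_of_degree_lt h1 ?_
      rw [degree_eq_natDegree hf.ne_zero]
      exact degree_sum_fin_lt c
    intro j
    have := congrArg (fun p ↦ p.coeff (j : ℕ)) h2
    simpa [finsetSum_coeff, coeff_C_mul, coeff_X_pow, Fin.val_inj] using this
  obtain ⟨θ, P, hP, hP0, hcard, hPθ⟩ :=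
    exists_irreducible_aeval_eq_zero (linearIndependent_smul hb' hpow)
  obtain ⟨Θ, rfl⟩ := AdjoinRoot.mk_surjective θ
  refine ⟨Θ, P, hP, hP0, by simpa using hcard, ?_⟩
  rw [← AdjoinRoot.mk_eq_zero, hom_eval₂]
  exact hPθ

theorem MvPolynomial.isIntegral_expand {σ R : Type*} [CommRing R] {d : ℕ} (hd : 0 < d) :
    (expand d : MvPolynomial σ R →ₐ[R] MvPolynomial σ R).toRingHom.IsIntegral := by
  intro p
  induction p using MvPolynomial.induction_on with
  | C a =>
    refine ⟨Polynomial.X - Polynomial.C (C a), monic_X_sub_C _, ?_⟩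
    rw [Polynomial.eval₂_sub, Polynomial.eval₂_X, Polynomial.eval₂_C, sub_eq_zero]
    exact (expand_C d a).symm
  | add p q hp hq => exact hp.add _ hq
  | mul_X p n hp =>
    refine hp.mul _ ⟨Polynomial.X ^ d - Polynomial.C (X n), monic_X_pow_sub_C _ hd.ne', ?_⟩
    rw [Polynomial.eval₂_sub, Polynomial.eval₂_X_pow, Polynomial.eval₂_C, sub_eq_zero]
    exact (expand_X d n).symm

theorem MvPolynomial.finiteType_expand {σ R : Type*} [CommRing R] [Finite σ] (d : ℕ) :
    (expand d : MvPolynomial σ R →ₐ[R] MvPolynomial σ R).toRingHom.FiniteType := by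
  refine RingHom.FiniteType.of_comp_finiteType (f := (C : R →+* MvPolynomial σ R)) ?_
  have : (expand d : MvPolynomial σ R →ₐ[R] MvPolynomial σ R).toRingHom.comp C = C := by
    ext1 r
    simp
  rw [this, ← algebraMap_eq, RingHom.finiteType_algebraMap]
  infer_instance

theorem MvPolynomial.eq_zero_of_sum_expand_mul_monomial {σ R : Type*} [CommRing R] [Fintype σ]
    [DecidableEq σ] {d : ℕ} (c : (σ → Fin d) → MvPolynomial σ R)
    (h : ∑ e, expand d (c e) *
      monomial (Finsupp.equivFunOnFinite.symm fun i ↦ (e i : ℕ)) (1 : R) = 0)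
    (e : σ → Fin d) : c e = 0 := by
  by_cases hd : d = 0
  · subst hd
    have : IsEmpty σ := ⟨fun i ↦ (e i).elim0⟩
    have he : ∀ e' : σ → Fin 0, e' = e := fun e' ↦ Subsingleton.elim _ _
    rw [Fintype.sum_eq_single e fun e' h ↦ (h (he e')).elim] at h
    rw [eq_C_of_isEmpty (c e)] at h ⊢
    have h0 : (Finsupp.equivFunOnFinite.symm fun i ↦ (e i : ℕ)) = (0 : σ →₀ ℕ) :=
      Subsingleton.elim _ _
    rw [h0] at h
    simpa using h
  ext u
  have h1 := congrArg (coeff (d • u + Finsupp.equivFunOnFinite.symm fun i ↦ (e i : ℕ))) h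
  rw [coeff_sum, Finset.sum_eq_single e] at h1
  · rw [coeff_mul_monomial] at h1
    simpa [coeff_expand_smul d hd] using h1
  · intro e' _ hne
    rw [coeff_mul_monomial']
    split_ifs with hle
    · obtain ⟨i, hi⟩ := Function.ne_iff.1 hne
      rw [mul_one]
      refine coeff_expand_of_not_dvd (c e') (i := i) fun hdvd ↦ hi ?_
      have hle' := hle i
      simp only [Finsupp.coe_tsub, Finsupp.coe_add, Finsupp.coe_smul, Pi.sub_apply, Pi.add_apply,
        Pi.smul_apply, smul_eq_mul, Finsupp.equivFunOnFinite_symm_apply_apply] at hdvd hle'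
      have h2 : (e' i : ℕ) ≡ d * u i + e i [MOD d] := (Nat.modEq_iff_dvd' hle').2 hdvd
      have h3 : (e' i : ℕ) ≡ e i [MOD d] := h2.trans (by simp [Nat.ModEq])
      exact Fin.ext (h3.eq_of_lt_of_lt (e' i).2 (e i).2)
    · rfl
  · simp

theorem RingHom.exists_comp_algebraMap_eq_of_isIntegral {R S M : Type*} [CommRing R] [CommRing S]
    [IsDomain S] [Field M] [IsAlgClosed M] [Algebra R S] [FaithfulSMul R S]
    [Algebra.IsIntegral R S] (e : R →+* M) : ∃ e' : S →+* M, e'.comp (algebraMap R S) = e := by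
  have : (RingHom.ker e).IsPrime := RingHom.ker_isPrime e
  obtain ⟨Q, -, hQ, hQe⟩ := Ideal.exists_ideal_over_prime_of_isIntegral (S := S) (RingHom.ker e) ⊥
    (by
      rw [← RingHom.ker_eq_comap_bot, (RingHom.injective_iff_ker_eq_bot _).1
        (FaithfulSMul.algebraMap_injective R S)]
      exact bot_le)
  have : Q.LiesOver (RingHom.ker e) := ⟨hQe.symm⟩
  let e₀ : R ⧸ RingHom.ker e →+* M := RingHom.kerLift e
  let : Algebra (R ⧸ RingHom.ker e) M := e₀.toAlgebra
  have : FaithfulSMul (R ⧸ RingHom.ker e) M :=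
    (faithfulSMul_iff_algebraMap_injective _ _).2 (RingHom.kerLift_injective e)
  have : IsDomain (R ⧸ RingHom.ker e) := inferInstance
  have : IsDomain (S ⧸ Q) := inferInstance
  have : FaithfulSMul (R ⧸ RingHom.ker e) (S ⧸ Q) := Ideal.Quotient.instFaithfulSMul Q _
  have : Module.IsTorsionFree (R ⧸ RingHom.ker e) (S ⧸ Q) := FaithfulSMul.to_isTorsionFree _ _
  have : Module.IsTorsionFree (R ⧸ RingHom.ker e) M := FaithfulSMul.to_isTorsionFree _ _
  have : Algebra.IsIntegral (R ⧸ RingHom.ker e) (S ⧸ Q) := inferInstance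
  let L : S ⧸ Q →ₐ[R ⧸ RingHom.ker e] M := IsAlgClosed.lift
  refine ⟨L.toRingHom.comp (Ideal.Quotient.mk Q), ?_⟩
  ext r
  exact (L.commutes (Ideal.Quotient.mk _ r)).trans (RingHom.kerLift_mk e r)

theorem IntermediateField.finrank_adjoin_image_le {k K : Type*} [Field k] [Field K] [Algebra k K]
    {σ : Type*} [DecidableEq σ] {d : ℕ} (hd : 0 < d) {ζ : σ → K}
    {c : σ → k} (hζ : ∀ i, ζ i ^ d = algebraMap k K (c i)) (s : Finset σ) :
    Module.finrank k (adjoin k (ζ '' s)) ≤ d ^ s.card := by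
  induction s using Finset.induction_on with
  | empty =>
    rw [Finset.coe_empty, Set.image_empty, adjoin_empty]
    simp
  | insert a s ha ih =>
    have hint : IsIntegral k (ζ a) := .of_pow hd (hζ a ▸ isIntegral_algebraMap)
    have h1 : Module.finrank k (adjoin k {ζ a}) ≤ d := by
      rw [adjoin.finrank hint]
      refine (natDegree_le_of_dvd (minpoly.dvd k (ζ a) (p := X ^ d - C (c a))
        (by simp [hζ])) (monic_X_pow_sub_C _ hd.ne').ne_zero).trans ?_
      rw [natDegree_X_pow_sub_C]
    rw [Finset.coe_insert, Set.image_insert_eq, ← Set.singleton_union,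
      adjoin_union, Finset.card_insert_of_notMem ha, pow_succ']
    exact (finrank_sup_le _ _).trans (Nat.mul_le_mul h1 ih)

theorem IntermediateField.finrank_adjoin_image_eq {k K : Type*} [Field k] [Field K] [Algebra k K]
    {σ : Type*} [Fintype σ] [DecidableEq σ] {d : ℕ} (hd : 0 < d) {ζ : σ → K}
    {c : σ → k} (hζ : ∀ i, ζ i ^ d = algebraMap k K (c i))
    (h : d ^ Fintype.card σ ≤ Module.finrank k (adjoin k (Set.range ζ))) (s : Finset σ) :
    Module.finrank k (adjoin k (ζ '' s)) = d ^ s.card := by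
  refine le_antisymm (finrank_adjoin_image_le hd hζ s) ?_
  have h1 : adjoin k (Set.range ζ) = adjoin k (ζ '' s) ⊔ adjoin k (ζ '' ↑(sᶜ)) := by
    rw [← adjoin_union, ← Set.image_union, Finset.coe_compl, Set.union_compl_self, Set.image_univ]
  rw [h1, ← Finset.card_add_card_compl s, pow_add] at h
  have h2 := h.trans ((finrank_sup_le _ _).trans
    (Nat.mul_le_mul_left _ (finrank_adjoin_image_le hd hζ sᶜ)))
  exact Nat.le_of_mul_le_mul_right h2 (pow_pos hd _)

theorem RingHom.IsIntegral.exists_ne_zero_dvd {A B : Type*} [CommRing A] [IsDomain A] [CommRing B]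
    [IsDomain B] {i : A →+* B} (hint : i.IsIntegral) {h : B} (h0 : h ≠ 0) :
    ∃ q : A, q ≠ 0 ∧ h ∣ i q := by
  let : Algebra A B := i.toAlgebra
  have hh : _root_.IsIntegral A h := hint h
  exact hh.isAlgebraic.exists_nonzero_dvd (mem_nonZeroDivisors_of_ne_zero h0)

theorem IsHilbertian.exists_irreducible_map_eval {k kbar : Type*} [Field k] [Field kbar]
    [Algebra k kbar] (hk : IsHilbertian k kbar) {m : ℕ} (hm : 0 < m)
    (fs : Finset (MvPolynomial (Fin m) k)[X])
    (hfs : ∀ f ∈ fs, Irreducible f ∧ 0 < f.natDegree) {g : MvPolynomial (Fin m) k} (hg : g ≠ 0) :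
    ∃ c : Fin m → k, MvPolynomial.eval c g ≠ 0 ∧
      ∀ f ∈ fs, Irreducible (f.map (MvPolynomial.eval c)) := by
  let e : k ≃+* (⊥ : IntermediateField k kbar) := (IntermediateField.botEquiv k kbar).symm.toRingEquiv
  have he : (e : k →+* (⊥ : IntermediateField k kbar)) = algebraMap k _ :=
    RingHom.ext fun x ↦ (IntermediateField.botEquiv k kbar).symm.commutes x
  have hcond : ∀ f ∈ fs, 0 < f.natDegree ∧ Irreducible (f.map ((algebraMap (MvPolynomial (Fin m)
      (⊥ : IntermediateField k kbar)) (FractionRing (MvPolynomial (Fin m)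
        (⊥ : IntermediateField k kbar)))).comp (MvPolynomial.map (algebraMap k _)))) := by
    intro f hf
    obtain ⟨h1, h2⟩ := hfs f hf
    refine ⟨h2, ?_⟩
    rw [← Polynomial.map_map, ← he]
    have h3 : Irreducible (f.map (MvPolynomial.map (σ := Fin m)
        (e : k →+* (⊥ : IntermediateField k kbar)))) :=
      (MulEquiv.irreducible_iff (Polynomial.mapEquiv (MvPolynomial.mapEquiv (Fin m) e))).2 h1
    refine h3.map_fractionRing ?_
    rw [natDegree_map_eq_of_injective (MvPolynomial.map_injective _ e.injective)]
    exact h2.ne'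
  obtain ⟨c, hc, hirr⟩ := hk ⊥ inferInstance m hm fs hcond g hg
  refine ⟨c, hc, fun f hf ↦ ?_⟩
  have h := hirr f hf
  rw [← Polynomial.map_map, ← he] at h
  exact (MulEquiv.irreducible_iff (Polynomial.mapEquiv e)).1 h

theorem MvPolynomial.isUnit_aeval_of_mem_powers {σ k F : Type*} [Field k] [Field F] [Algebra k F]
    {δ : MvPolynomial σ k} {w : σ → F} (hw : aeval w δ ≠ 0) (y : Submonoid.powers δ) :
    IsUnit (aeval w (y : MvPolynomial σ k)) := by
  obtain ⟨_, n, rfl⟩ := y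
  simpa using pow_ne_zero n hw

theorem exists_algHom_Dalg {Ω k kbar : Type*} [Field Ω] [IsAlgClosed Ω] [CharZero Ω] [Field k]
    [Algebra k Ω] [Field kbar] [Algebra k kbar] [IsAlgClosed kbar]
    {m : ℕ} {z : Fin m → Ω} {δ : MvPolynomial (Fin m) k}
    {η : Ω} (hz : AlgebraicIndependent k z) (hδ : δ ≠ 0)
    (hη : IsIntegral ↥(Algebra.adjoin k (Set.range z ∪ {(MvPolynomial.aeval z δ)⁻¹})) η)
    {ζ : Fin m → kbar} (hζ : MvPolynomial.aeval ζ δ ≠ 0) :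
    ∃ φ : ↥(Dalg k z δ η) →ₐ[k] kbar, ∀ i, φ ⟨z i, z_mem k z δ η i⟩ = ζ i := by
  let B := MvPolynomial (Fin m) k
  let L := Localization.Away δ
  have hzδ : MvPolynomial.aeval z δ ≠ 0 := by
    rwa [Ne, map_eq_zero_iff _ hz]
  let j : L →ₐ[k] Ω := IsLocalization.liftAlgHom (M := Submonoid.powers δ)
    (f := MvPolynomial.aeval z) (MvPolynomial.isUnit_aeval_of_mem_powers hzδ)
  let e : L →ₐ[k] kbar := IsLocalization.liftAlgHom (M := Submonoid.powers δ)
    (f := MvPolynomial.aeval ζ) (MvPolynomial.isUnit_aeval_of_mem_powers hζ)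
  have hj (p : B) : j (algebraMap B L p) = MvPolynomial.aeval z p := IsLocalization.lift_eq _ p
  have he (p : B) : e (algebraMap B L p) = MvPolynomial.aeval ζ p := IsLocalization.lift_eq _ p
  have hjinj : Function.Injective j := by
    rw [injective_iff_map_eq_zero]
    intro x hx
    obtain ⟨p, s, rfl⟩ := IsLocalization.exists_mk'_eq (Submonoid.powers δ) x
    have h1 := congrArg j (IsLocalization.mk'_spec L p s)
    rw [map_mul, hx, zero_mul, hj, eq_comm, map_eq_zero_iff _ hz] at h1
    rw [h1, IsLocalization.mk'_zero]
  let : Algebra L Ω := j.toRingHom.toAlgebra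
  have : IsScalarTower k L Ω := .of_algebraMap_eq fun x ↦ (j.commutes x).symm
  let E := integralClosure L Ω
  have hL (x : L) : j x ∈ E := E.algebraMap_mem x
  have hzE (i : Fin m) : z i ∈ E := by
    have := hL (algebraMap B L (MvPolynomial.X i))
    rwa [hj, MvPolynomial.aeval_X] at this
  have hδE : (MvPolynomial.aeval z δ)⁻¹ ∈ E := by
    have := hL (IsLocalization.Away.invSelf δ)
    convert this
    refine (eq_inv_of_mul_eq_one_right ?_).symm
    rw [← hj, ← map_mul, IsLocalization.Away.mul_invSelf, map_one]
  have hR : Algebra.adjoin k (Set.range z ∪ {(MvPolynomial.aeval z δ)⁻¹}) ≤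
      E.restrictScalars k := by
    refine Algebra.adjoin_le (Set.union_subset ?_ (by simpa using hδE))
    rintro _ ⟨i, rfl⟩
    exact hzE i
  have hηE : η ∈ E := by
    obtain ⟨p, hp, hpη⟩ := hη
    let i : Algebra.adjoin k (Set.range z ∪ {(MvPolynomial.aeval z δ)⁻¹}) →+* E :=
      (Subalgebra.inclusion hR).toRingHom
    have : IsIntegral E η := ⟨p.map i, hp.map i, by rw [eval₂_map]; exact hpη⟩
    exact isIntegral_trans η this
  have hD : Dalg k z δ η ≤ E.restrictScalars k := by
    refine Algebra.adjoin_le (Set.union_subset ?_ ?_)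
    · rintro _ ⟨i, rfl⟩
      exact hzE i
    · rintro x (rfl | rfl)
      exacts [hδE, hηE]
  have : FaithfulSMul L E := (faithfulSMul_iff_algebraMap_injective _ _).2 fun x y hxy ↦
    hjinj (congrArg Subtype.val hxy)
  obtain ⟨e', he'⟩ := RingHom.exists_comp_algebraMap_eq_of_isIntegral (S := E) e.toRingHom
  have he'' (x : L) : e' (algebraMap L E x) = e x := RingHom.congr_fun he' x
  refine ⟨{ e'.comp (Subalgebra.inclusion hD).toRingHom with commutes' := fun r ↦ ?_ }, fun i ↦ ?_⟩
  · rw [← e.commutes r, ← he'']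
    refine congrArg e' (Subtype.ext ?_)
    exact (j.commutes r).symm
  · rw [← MvPolynomial.aeval_X (R := k) ζ i, ← he, ← he'']
    refine congrArg e' (Subtype.ext ?_)
    exact ((hj _).trans (MvPolynomial.aeval_X z i)).symm

open IntermediateField in
theorem irreducible_map_of_irreducible_map_eval {k K : Type*} [Field k] [Field K] [IsAlgClosed K]
    [Algebra k K] {m d : ℕ} (hd : 0 < d) {ζ : Fin m → K} {c : Fin m → k}
    (hζ : ∀ i, ζ i ^ d = algebraMap k K (c i))
    (F : IntermediateField k K) (hF : F = adjoin k (Set.range ζ)) (ψ : MvPolynomial (Fin m) k →ₐ[k] F)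
    (hψ : ∀ i, (ψ (MvPolynomial.X i) : K) = ζ i) {f Θ P : (MvPolynomial (Fin m) k)[X]}
    (hf : 0 < f.natDegree) (hlc : MvPolynomial.aeval ζ f.leadingCoeff ≠ 0)
    (hP : Irreducible (P.map (MvPolynomial.eval c)))
    (hPlc : MvPolynomial.eval c P.leadingCoeff ≠ 0)
    (hdeg : d ^ m * f.natDegree ≤ P.natDegree)
    (hdvd : f ∣ eval₂ (C.comp (MvPolynomial.expand d).toRingHom) Θ P) :
    d ^ m ≤ Module.finrank k F ∧
      0 < (f.map ψ.toRingHom).natDegree ∧ Irreducible (f.map ψ.toRingHom) := by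
  have hψ' (p : MvPolynomial (Fin m) k) : (ψ p : K) = MvPolynomial.aeval ζ p :=
    DFunLike.congr_fun (MvPolynomial.algHom_ext (f := F.val.comp ψ) (by simpa using hψ)) p
  have hint (i : Fin m) : IsIntegral k (ζ i) := .of_pow hd (hζ i ▸ isIntegral_algebraMap)
  have : FiniteDimensional k F := by
    rw [hF]
    refine finiteDimensional_adjoin ?_
    rintro _ ⟨i, rfl⟩
    exact hint i
  have hdegf : (f.map ψ.toRingHom).natDegree = f.natDegree := by
    refine natDegree_map_of_leadingCoeff_ne_zero _ fun h ↦ hlc ?_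
    rw [← hψ']
    exact congrArg Subtype.val h
  obtain ⟨β, hβ⟩ := IsAlgClosed.exists_aeval_eq_zero K (f.map ψ.toRingHom)
    (degree_ne_of_natDegree_ne (n := 0) (by omega))
  have hf0 : f.map ψ.toRingHom ≠ 0 := fun h ↦ by rw [h, natDegree_zero] at hdegf; omega
  have hβint : IsIntegral F β := IsAlgebraic.isIntegral ⟨_, hf0, hβ⟩
  have hmin : minpoly F β ∣ f.map ψ.toRingHom := minpoly.dvd _ _ hβ
  have : FiniteDimensional F F⟮β⟯ := adjoin.finiteDimensional hβint
  have : FiniteDimensional k F⟮β⟯ := .trans k F F⟮β⟯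
  let ev : (MvPolynomial (Fin m) k)[X] →+* F⟮β⟯ :=
    eval₂RingHom ((algebraMap F F⟮β⟯).comp ψ.toRingHom) (AdjoinSimple.gen F β)
  have hevf : ev f = 0 := by
    refine Subtype.ext ?_
    rw [aeval_def, eval₂_map] at hβ
    have := hom_eval₂ f ((algebraMap F F⟮β⟯).comp ψ.toRingHom) (algebraMap F⟮β⟯ K)
      (AdjoinSimple.gen F β)
    exact this.trans hβ
  have hcomp : ev.comp (C.comp (MvPolynomial.expand d).toRingHom) =
      (algebraMap k F⟮β⟯).comp (MvPolynomial.eval c) := by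
    refine MvPolynomial.ringHom_ext (fun r ↦ ?_) (fun i ↦ ?_)
    · simp [ev, ← MvPolynomial.algebraMap_eq, ← IsScalarTower.algebraMap_apply]
    · have h1 : (ev (C (MvPolynomial.X i)) : K) = ζ i := by
        rw [coe_eval₂RingHom, eval₂_C]
        exact hψ i
      have h2 : (C.comp (MvPolynomial.expand d).toRingHom) (MvPolynomial.X i) =
          (C (MvPolynomial.X i) ^ d : (MvPolynomial (Fin m) k)[X]) := by
        rw [← C_pow]
        exact congrArg C (MvPolynomial.expand_X d i)
      rw [RingHom.comp_apply, h2, map_pow, RingHom.comp_apply, MvPolynomial.eval_X]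
      refine Subtype.ext ?_
      rw [SubmonoidClass.coe_pow, h1, hζ]
      rfl
  have hroot : aeval (ev Θ) (P.map (MvPolynomial.eval c)) = 0 := by
    rw [aeval_def, eval₂_map, ← hcomp, ← hom_eval₂]
    obtain ⟨r, hr⟩ := hdvd
    rw [hr, map_mul, hevf, zero_mul]
  have hPdeg : P.natDegree ≤ (minpoly k (ev Θ)).natDegree := by
    rw [← minpoly.eq_of_irreducible hP hroot,
      natDegree_mul_C (inv_ne_zero (leadingCoeff_ne_zero.2 hP.ne_zero)),
      natDegree_map_of_leadingCoeff_ne_zero _ hPlc]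
  have : Module.Free F F⟮β⟯ := Module.Free.of_divisionRing F F⟮β⟯
  have hle : P.natDegree ≤ Module.finrank k F * (minpoly F β).natDegree := by
    rw [← adjoin.finrank hβint, Module.finrank_mul_finrank k F F⟮β⟯]
    exact hPdeg.trans (minpoly.natDegree_le _)
  have hFle : Module.finrank k F ≤ d ^ m := by
    have h := finrank_adjoin_image_le hd hζ Finset.univ
    rwa [Finset.coe_univ, Set.image_univ, Finset.card_univ, Fintype.card_fin, ← hF] at h
  have hβle : (minpoly F β).natDegree ≤ f.natDegree :=
    hdegf ▸ natDegree_le_of_dvd hmin hf0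
  have hdm : 0 < d ^ m := pow_pos hd m
  have h1 : d ^ m ≤ Module.finrank k F :=
    Nat.le_of_mul_le_mul_right (hdeg.trans (hle.trans (Nat.mul_le_mul_left _ hβle))) hf
  have h2 : f.natDegree ≤ (minpoly F β).natDegree :=
    Nat.le_of_mul_le_mul_left (hdeg.trans (hle.trans (Nat.mul_le_mul_right _ hFle))) hdm
  refine ⟨h1, by omega, ?_⟩
  exact (associated_of_dvd_of_natDegree_le hmin hf0 (by omega)).irreducible
    (minpoly.irreducible hβint)

/-- Proposition 2.9 of the paper. Under hypothesis (H), if `k` is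
hilbertian then `ℋ_D(d,𝐟,g)` is nonempty. -/
theorem Hset_nonempty
    {Ω : Type*} [Field Ω] [IsAlgClosed Ω] [CharZero Ω]
    (k : Type*) [Field k] [Algebra k Ω]
    (kbar : Type*) [Field kbar] [Algebra k kbar] [IsAlgClosure k kbar]
    {m : ℕ} (z : Fin m → Ω) (δ : MvPolynomial (Fin m) k) (η : Ω)
    -- hypothesis (H)
    (hm : 0 < m) (hz : AlgebraicIndependent k z) (hδ : δ ≠ 0)
    (hη : IsIntegral ↥(Algebra.adjoin k (Set.range z ∪ {(MvPolynomial.aeval z δ)⁻¹})) η)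
    -- `k` is hilbertian
    (hk : IsHilbertian k kbar)
    (d : ℕ) (hd : 0 < d)
    (fs : Finset (Polynomial (MvPolynomial (Fin m) k)))
    (hfs : ∀ f ∈ fs, Irreducible f ∧ 0 < f.natDegree)
    (g : MvPolynomial (Fin m) k) (hg : g ≠ 0) :
    (Hset k kbar z δ η d fs g).Nonempty := by
  classical
  have : IsAlgClosed kbar := IsAlgClosure.isAlgClosed k
  have : CharZero k := (algebraMap k Ω).charZero
  let i : MvPolynomial (Fin m) k →+* MvPolynomial (Fin m) k :=
    (MvPolynomial.expand d : MvPolynomial (Fin m) k →ₐ[k] MvPolynomial (Fin m) k).toRingHom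
  have hint : i.IsIntegral := MvPolynomial.isIntegral_expand hd
  have hfs' : ∀ f ∈ insert X fs, Irreducible f ∧ 0 < f.natDegree := by
    intro f hf
    rcases Finset.mem_insert.1 hf with rfl | hf
    exacts [⟨irreducible_X, by simp⟩, hfs f hf]
  choose! Θ P hP hP0 hdeg hdvd using fun f hf ↦ exists_irreducible_dvd_eval₂ i
    (MvPolynomial.expand_injective hd) hint (MvPolynomial.finiteType_expand d)
    MvPolynomial.eq_zero_of_sum_expand_mul_monomial (hfs' f hf).1 (hfs' f hf).2
  choose! q hq0 hq using fun (h : MvPolynomial (Fin m) k) (h0 : h ≠ 0) ↦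
    hint.exists_ne_zero_dvd h0
  have hlc {f} (hf : f ∈ insert X fs) : f.leadingCoeff ≠ 0 :=
    leadingCoeff_ne_zero.2 (hfs' f hf).1.ne_zero
  obtain ⟨c, hc, hirr⟩ := hk.exists_irreducible_map_eval hm ((insert X fs).image P)
    (Finset.forall_mem_image.2 fun f hf ↦ ⟨hP f hf, hP0 f hf⟩)
    (g := q g * q δ * ∏ f ∈ insert X fs, (q f.leadingCoeff * (P f).leadingCoeff))
    (mul_ne_zero (mul_ne_zero (hq0 g hg) (hq0 δ hδ)) (Finset.prod_ne_zero_iff.2 fun f hf ↦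
      mul_ne_zero (hq0 _ (hlc hf)) (leadingCoeff_ne_zero.2 (hP f hf).ne_zero)))
  rw [map_mul, map_mul, map_prod, mul_ne_zero_iff, mul_ne_zero_iff, Finset.prod_ne_zero_iff] at hc
  obtain ⟨⟨hcg, hcδ⟩, hcf⟩ := hc
  choose ζ₀ hζ₀ using fun j ↦ IsAlgClosed.exists_pow_nat_eq (algebraMap k kbar (c j)) hd
  have hne {ζ : Fin m → kbar} (hζ : ∀ j, ζ j ^ d = algebraMap k kbar (c j))
      {h : MvPolynomial (Fin m) k} (h0 : h ≠ 0) (hh : MvPolynomial.eval c (q h) ≠ 0) :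
      MvPolynomial.aeval ζ h ≠ 0 := by
    intro h1
    have h2 := map_dvd (MvPolynomial.aeval ζ) (hq h h0)
    rw [h1, zero_dvd_iff] at h2
    have h3 : MvPolynomial.aeval ζ (i (q h)) = algebraMap k kbar (MvPolynomial.eval c (q h)) := by
      refine (MvPolynomial.aeval_expand d ζ (q h)).trans ?_
      rw [show ζ ^ d = fun j ↦ algebraMap k kbar (c j) from funext hζ]
      exact MvPolynomial.aeval_algebraMap_apply kbar c (q h)
    rw [h2, eq_comm, map_eq_zero] at h3
    exact hh h3
  obtain ⟨φ, hφ⟩ := exists_algHom_Dalg hz hδ hη (hne hζ₀ hδ hcδ)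
  have hζ (j : Fin m) : φ ⟨z j, z_mem k z δ η j⟩ ^ d = algebraMap k kbar (c j) := by
    rw [hφ, hζ₀]
  have key {f} (hf : f ∈ insert X fs) := irreducible_map_of_irreducible_map_eval hd hζ _ rfl
    (MvPolynomial.aeval fun j ↦ ⟨φ ⟨z j, z_mem k z δ η j⟩,
      IntermediateField.subset_adjoin k _ ⟨j, rfl⟩⟩) (fun j ↦ by rw [MvPolynomial.aeval_X])
    (hfs' f hf).2 (hne hζ (hlc hf) (left_ne_zero_of_mul (map_mul (MvPolynomial.eval c) _ _ ▸ hcf f hf)))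
    (hirr _ (Finset.mem_image_of_mem P hf))
    (right_ne_zero_of_mul (map_mul (MvPolynomial.eval c) _ _ ▸ hcf f hf))
    (by simpa using hdeg f hf) (hdvd f hf)
  refine ⟨φ, ?_, fun j ↦ ?_, fun f hf ↦ (key (Finset.mem_insert_of_mem hf)).2⟩
  · have h1 := hne hζ hg hcg
    have h2 : φ ⟨MvPolynomial.aeval z g, aeval_mem k z δ η g⟩ =
        MvPolynomial.aeval (fun j ↦ φ ⟨z j, z_mem k z δ η j⟩) g := by
      rw [← MvPolynomial.comp_aeval_apply]
      refine congrArg φ (Subtype.ext ?_)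
      exact (MvPolynomial.comp_aeval_apply (fun j ↦ (⟨z j, z_mem k z δ η j⟩ : Dalg k z δ η))
        (Dalg k z δ η).val g).symm
    rwa [h2]
  · have h1 := IntermediateField.finrank_adjoin_image_eq hd hζ
      (by simpa using (key (Finset.mem_insert_self X fs)).1) (Finset.Iic j)
    rw [Fin.card_Iic, Finset.coe_Iic] at h1
    exact h1
end

section
/- Assume hypothesis (H). Let f ∈ F[y] be a polynomial irreducible over F, and let b ∈ D be nonzero. Then there exist an irreducible polynomial h ∈ k[z,y] ∖ k[z], a nonzero g ∈ k[z], and a nonzero q ∈ D such that every coefficient of f lies in the localization D[1/q] ⊆ F, and such that for every positive integer d and every φ ∈ ℋ_D(d,{h},g) one has φ(q) ≠ 0, so φ extends uniquely to a k-algebra homomorphism on D[1/q] (still denoted φ), and moreover: (1) the polynomial φ(f) obtained by applying φ to the coefficients of f is irreducible over the field φ(D); (2) deg_y(φ(f)) = deg_y(f); (3) φ(b) ≠ 0. -/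
set_option linter.unusedSectionVars false
set_option linter.unusedVariables false

section HypH2

variable {Ω : Type*} [Field Ω] [IsAlgClosed Ω] [CharZero Ω]
variable (k : Type*) [Field k] [Algebra k Ω]
variable {m : ℕ} (z : Fin m → Ω) (δ : MvPolynomial (Fin m) k) (η : Ω)

/-- The localization `D[1/q]` of `D` inside `Ω`. -/
noncomputable def Dadj (q : ↥(Dalg k z δ η)) : Subalgebra k Ω :=
  Algebra.adjoin k ((Dalg k z δ η : Set Ω) ∪ {(q : Ω)⁻¹})

theorem le_Dadj (q : ↥(Dalg k z δ η)) : Dalg k z δ η ≤ Dadj k z δ η q :=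
  fun _ hx => Algebra.subset_adjoin (Set.mem_union_left _ hx)

/-- The field of fractions `F` of `D` inside `Ω` (the subfield generated by `D`). -/
noncomputable def Ffield : Subfield Ω := Subfield.closure (Dalg k z δ η : Set Ω)

end HypH2

open Polynomial

open IntermediateField in
theorem exists_monic_irreducible_dvd_comp {R F : Type*} [CommRing R] [IsDomain R]
    [IsIntegrallyClosed R] [CharZero R] [Field F] [Algebra R F] [FaithfulSMul R F]
    (η : F) (hη : IsAlgebraic R η)
    (htop : Subfield.closure (Set.range (algebraMap R F) ∪ {η}) = ⊤)
    (f : F[X]) (hf : Irreducible f) :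
    ∃ (h P : R[X]) (W : F[X]), h.Monic ∧ Irreducible h ∧ P ≠ 0 ∧ aeval η P = 0 ∧
      h.natDegree = P.natDegree * f.natDegree ∧ f ∣ (h.map (algebraMap R F)).comp W := by
  let K := FractionRing R
  let : Algebra K F := FractionRing.liftAlgebra R F
  have hηK : IsAlgebraic K η := hη.extendScalars (IsFractionRing.injective R K)
  have hηi : IsIntegral K η := hηK.isIntegral
  have hK : K⟮η⟯ = ⊤ := by
    rw [eq_top_iff]
    intro x _
    have hx : x ∈ Subfield.closure (Set.range (algebraMap R F) ∪ {η}) := htop ▸ Subfield.mem_top x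
    have hle : Subfield.closure (Set.range (algebraMap R F) ∪ {η}) ≤ K⟮η⟯.toSubfield := by
      rw [Subfield.closure_le]
      rintro _ (⟨r, rfl⟩ | rfl)
      · rw [IsScalarTower.algebraMap_apply R K F]
        exact K⟮η⟯.algebraMap_mem _
      · exact mem_adjoin_simple_self K _
    exact hle hx
  have : FiniteDimensional K F := by
    have := adjoin.finiteDimensional hηi
    rw [hK] at this
    exact Module.Finite.equiv (topEquiv (F := K) (E := F)).toLinearEquiv
  have hdegF : (minpoly K η).natDegree = Module.finrank K F := by
    rw [← adjoin.finrank hηi, hK, finrank_top']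
  have := Fact.mk hf
  let L := AdjoinRoot f
  have hf0 : f ≠ 0 := hf.ne_zero
  have : FiniteDimensional F L := (AdjoinRoot.powerBasis hf0).finite
  have hdegL : Module.finrank F L = f.natDegree := by
    rw [(AdjoinRoot.powerBasis hf0).finrank, AdjoinRoot.powerBasis_dim]
  have : FiniteDimensional K L := FiniteDimensional.trans K F L
  obtain ⟨α, hα⟩ := Field.exists_primitive_element K L
  have hαR : IsAlgebraic R α :=
    (IsFractionRing.isAlgebraic_iff R K L).2 (Algebra.IsAlgebraic.isAlgebraic α)
  obtain ⟨r, hr, hw⟩ := hαR.exists_integral_multiple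
  set w := r • α with hw_def
  have hwtop : K⟮w⟯ = ⊤ := by
    rw [eq_top_iff, ← hα, adjoin_simple_le_iff]
    have hr' : algebraMap R K r ≠ 0 := by simpa using hr
    have : α = (algebraMap R K r)⁻¹ • w := by
      rw [hw_def, ← algebraMap_smul K r α, smul_smul, inv_mul_cancel₀ hr', one_smul]
    rw [this]
    exact K⟮w⟯.smul_mem (mem_adjoin_simple_self K w)
  have hmin := minpoly.isIntegrallyClosed_eq_field_fractions' K hw
  have hdegh : (minpoly R w).natDegree = Module.finrank K L := by
    rw [← finrank_top', ← hwtop, adjoin.finrank (hw.tower_top), hmin,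
      (minpoly.monic hw).natDegree_map]
  obtain ⟨W, hW⟩ := AdjoinRoot.mk_surjective (g := f) w
  obtain ⟨c, hc, hP⟩ := IsLocalization.integerNormalization_spec (nonZeroDivisors R) (minpoly K η)
  have hc0 : algebraMap R K c ≠ 0 := by simpa using nonZeroDivisors.ne_zero hc
  refine ⟨minpoly R w, IsLocalization.integerNormalization (nonZeroDivisors R) (minpoly K η), W,
    minpoly.monic hw, minpoly.irreducible hw, ?_, ?_, ?_, ?_⟩
  · rw [Ne, IsFractionRing.integerNormalization_eq_zero_iff]
    exact minpoly.ne_zero hηi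
  · exact IsLocalization.integerNormalization_aeval_eq_zero _ _ (minpoly.aeval K η)
  · rw [hdegh, ← Module.finrank_mul_finrank K F L, hdegL, ← hdegF,
      ← natDegree_map_eq_of_injective (IsFractionRing.injective R K)
        (IsLocalization.integerNormalization _ _), hP, ← algebraMap_smul K c,
      natDegree_smul _ hc0]
  · rw [← AdjoinRoot.mk_eq_zero, ← AdjoinRoot.aeval_eq, aeval_comp, AdjoinRoot.aeval_eq, hW,
      aeval_map_algebraMap, minpoly.aeval]

open IntermediateField in
theorem finrank_adjoin_simple_le_mul {κ C : Type*} [Field κ] [Field C] [Algebra κ C]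
    (E : IntermediateField κ C) [FiniteDimensional κ E] (G : IntermediateField E C)
    [FiniteDimensional E G] {w : C} (hw : w ∈ G) :
    Module.finrank κ κ⟮w⟯ ≤ Module.finrank κ E * Module.finrank E G := by
  have : FiniteDimensional κ G := FiniteDimensional.trans κ E G
  have : FiniteDimensional κ (restrictScalars κ G) := this
  have : Module.Free E G := Module.Free.of_divisionRing E G
  have : Module.Free κ E := Module.Free.of_divisionRing κ E
  rw [Module.finrank_mul_finrank κ E G]
  exact finrank_le_of_le_right (F := κ⟮w⟯) (E := restrictScalars κ G)
    (adjoin_simple_le_iff.2 hw)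
open IntermediateField in
theorem irreducible_of_dvd_comp_of_natDegree_eq {κ C B R : Type*} [Field κ] [Field C]
    [IsAlgClosed C] [Algebra κ C] [Algebra.IsAlgebraic κ C] [CommRing B] [CommRing R]
    (ι : R →+* B) (ψ : B →+* C) (ρ : R →+* κ) (hρ : ∀ r, ψ (ι r) = algebraMap κ C (ρ r))
    (β : C) (M : Subfield C) (hψ : ∀ x, ψ x ∈ M)
    (hMβ : M ≤ κ⟮β⟯.toSubfield)
    (h P : R[X]) (f W Q : B[X]) (hmonic : h.Monic) (hirr : Irreducible (h.map ρ))
    (hP : P.map ρ ≠ 0) (hPβ : aeval β (P.map ρ) = 0)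
    (hdeg : h.natDegree = P.natDegree * f.natDegree)
    (hdvd : (h.map ι).comp W = f * Q)
    (fM : M[X]) (hfM : fM.map M.subtype = f.map ψ) (hfdeg : fM.natDegree = f.natDegree)
    (hpos : 0 < f.natDegree) :
    Irreducible fM := by
  have hf0 : fM ≠ 0 := by
    rintro rfl
    simp at hfdeg
    omega
  obtain ⟨θ, hθ⟩ : ∃ θ, eval θ (fM.map M.subtype) = 0 := by
    refine IsAlgClosed.exists_root _ ?_
    rw [degree_map]
    exact (natDegree_pos_iff_degree_pos.1 (hfdeg ▸ hpos)).ne'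
  have hθi (N : IntermediateField κ C) : IsIntegral N θ :=
    (Algebra.IsIntegral.isIntegral (R := κ) θ).tower_top
  have hβi : IsIntegral κ β := Algebra.IsIntegral.isIntegral β
  set E := κ⟮β⟯ with hE
  set w := eval θ (W.map ψ) with hw
  have hroot : aeval w (h.map ρ) = 0 := by
    have hc : (algebraMap κ C).comp ρ = ψ.comp ι := by
      ext r; simp [hρ]
    have h1 := congrArg (fun p => eval θ (p.map ψ)) hdvd
    simp only [Polynomial.map_comp, Polynomial.map_mul, eval_comp, eval_mul, ← hfM, hθ,
      zero_mul, Polynomial.map_map] at h1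
    rw [aeval_def, eval₂_eq_eval_map, Polynomial.map_map, hc]
    exact h1
  have hmin := minpoly.eq_of_irreducible_of_monic hirr hroot (hmonic.map ρ)
  have hwi : IsIntegral κ w := Algebra.IsIntegral.isIntegral w
  have : FiniteDimensional κ E := adjoin.finiteDimensional hβi
  have : FiniteDimensional E E⟮θ⟯ := adjoin.finiteDimensional (hθi E)
  have hwmem : w ∈ E⟮θ⟯ := by
    rw [hw, eval_eq_sum_range]
    refine sum_mem fun i _ => mul_mem ?_ (pow_mem (mem_adjoin_simple_self E θ) i)
    rw [coeff_map]
    exact E⟮θ⟯.algebraMap_mem ⟨_, hMβ (hψ _)⟩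
  have h1 : P.natDegree * f.natDegree ≤ Module.finrank κ E * Module.finrank E E⟮θ⟯ := by
    rw [← hdeg, ← hmonic.natDegree_map ρ, hmin, ← adjoin.finrank hwi]
    exact finrank_adjoin_simple_le_mul E E⟮θ⟯ hwmem
  have h2 : Module.finrank κ E ≤ P.natDegree := by
    rw [hE, adjoin.finrank hβi]
    exact (natDegree_le_of_dvd (minpoly.dvd κ β hPβ) hP).trans natDegree_map_le
  have hPpos : 0 < P.natDegree := lt_of_lt_of_le Module.finrank_pos h2
  have h3 : f.natDegree ≤ (minpoly E θ).natDegree := by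
    rw [← adjoin.finrank (hθi E)]
    exact Nat.le_of_mul_le_mul_left (h1.trans (Nat.mul_le_mul_right _ h2)) hPpos
  have hθM : IsIntegral M θ := by
    rw [← isAlgebraic_iff_isIntegral]
    refine ⟨fM, hf0, ?_⟩
    rw [aeval_def, eval₂_eq_eval_map]
    exact hθ
  obtain ⟨c, hc⟩ := minpoly.dvd M θ (p := fM) (by rw [aeval_def, eval₂_eq_eval_map]; exact hθ)
  let j : M →+* E := M.subtype.codRestrict E fun x => hMβ x.2
  have h4 : (minpoly E θ).natDegree ≤ (minpoly M θ).natDegree := by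
    have hd : minpoly E θ ∣ (minpoly M θ).map j := by
      refine minpoly.dvd E θ ?_
      have := minpoly.aeval M θ
      rw [aeval_def] at this ⊢
      rw [eval₂_map]
      exact this
    exact (natDegree_le_of_dvd hd (Polynomial.map_ne_zero (minpoly.ne_zero hθM))).trans
      natDegree_map_le
  have hc0 : c ≠ 0 := by rintro rfl; simp at hc; exact hf0 hc
  have h5 : fM.natDegree = (minpoly M θ).natDegree + c.natDegree := by
    conv_lhs => rw [hc]
    exact natDegree_mul (minpoly.ne_zero hθM) hc0
  have hcu : IsUnit c := by
    rw [isUnit_iff_degree_eq_zero, degree_eq_natDegree hc0]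
    have : c.natDegree = 0 := by omega
    rw [this]; rfl
  rw [hc, irreducible_mul_isUnit hcu]
  exact minpoly.irreducible hθM

theorem exists_mul_eq_of_eval₂_eq_zero {R S : Type*} [CommRing R] [CommRing S] [IsDomain S]
    (ι : R →+* S) {x : S} (hx : x ≠ 0) {P : R[X]} (hP : P ≠ 0) (hPx : eval₂ ι x P = 0) :
    ∃ r, r ≠ 0 ∧ ∃ y, x * y = ι r := by
  let := ι.toAlgebra
  have hx' : IsAlgebraic R x := ⟨P, hP, hPx⟩
  obtain ⟨r, hr, y, hy⟩ := hx'.exists_nonzero_dvd (mem_nonZeroDivisors_of_ne_zero hx)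
  exact ⟨r, hr, y, hy.symm⟩

theorem existsUnique_comp_eq_of_forall_exists_pow_mul {k A B C : Type*} [CommRing k] [CommRing A]
    [CommRing B] [CommRing C] [Algebra k A] [Algebra k B] [Algebra k C] {i : A →ₐ[k] B}
    (hi : Function.Injective i) {q : A} (hq : IsUnit (i q))
    (hsurj : ∀ x : B, ∃ (n : ℕ) (y : A), i q ^ n * x = i y) {φ : A →ₐ[k] C} (hφ : IsUnit (φ q)) :
    ∃! ψ : B →ₐ[k] C, ψ.comp i = φ := by
  let : Algebra A B := i.toRingHom.toAlgebra
  have hmap (x : A) : algebraMap A B x = i x := rfl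
  have : IsScalarTower k A B := .of_algebraMap_eq fun c => (i.commutes c).symm
  have hloc : IsLocalization.Away q B := by
    refine ⟨?_, fun x => ?_, fun {x y} hxy => ⟨1, by rw [hi hxy]⟩⟩
    · rintro ⟨_, n, rfl⟩
      rw [map_pow]
      exact hq.pow n
    · obtain ⟨n, y, hy⟩ := hsurj x
      exact ⟨(y, ⟨q ^ n, n, rfl⟩), by rw [map_pow, hmap, hmap, mul_comm, hy]⟩
  have hu : ∀ y : Submonoid.powers q, IsUnit (φ y) := by
    rintro ⟨_, n, rfl⟩
    rw [map_pow]
    exact hφ.pow n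
  have hlift (x : A) : IsLocalization.liftAlgHom (S := B) hu (i x) = φ x :=
    IsLocalization.lift_eq (S := B) (g := φ.toRingHom) hu x
  refine ⟨IsLocalization.liftAlgHom hu, AlgHom.ext hlift, fun ψ hψ => ?_⟩
  refine IsLocalization.algHom_ext (Submonoid.powers q) (AlgHom.ext fun x => ?_)
  exact (DFunLike.congr_fun hψ x).trans (hlift x).symm

section Specialization

variable {Ω : Type*} [Field Ω] [IsAlgClosed Ω] [CharZero Ω]
variable {k : Type*} [Field k] [Algebra k Ω]
variable {kbar : Type*} [Field kbar] [Algebra k kbar]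
variable {m : ℕ} {z : Fin m → Ω} {δ : MvPolynomial (Fin m) k} {η : Ω}

variable (k z δ η) in
/-- Evaluation at `z` as a map `k[z] → D`. -/
noncomputable def toDalg : MvPolynomial (Fin m) k →ₐ[k] Dalg k z δ η :=
  (MvPolynomial.aeval z).codRestrict (Dalg k z δ η) (aeval_mem k z δ η)

variable (k z δ η) in
theorem eta_mem : η ∈ Dalg k z δ η :=
  Algebra.subset_adjoin (Set.mem_union_right _ (by simp))

theorem exists_eval₂_eq_zero_of_mem_Dalg
    (hη : IsIntegral ↥(Algebra.adjoin k (Set.range z ∪ {(MvPolynomial.aeval z δ)⁻¹})) η)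
    {x : Ω} (hx : x ∈ Dalg k z δ η) :
    ∃ P : (MvPolynomial (Fin m) k)[X], P ≠ 0 ∧
      eval₂ (MvPolynomial.aeval z : MvPolynomial (Fin m) k →ₐ[k] Ω).toRingHom x P = 0 := by
  let R := MvPolynomial (Fin m) k
  let : Algebra R Ω := (MvPolynomial.aeval z : R →ₐ[k] Ω).toRingHom.toAlgebra
  have hmap (r : R) : algebraMap R Ω r = MvPolynomial.aeval z r := rfl
  have : IsScalarTower k R Ω := .of_algebraMap_eq fun c =>
    ((MvPolynomial.aeval z : R →ₐ[k] Ω).commutes c).symm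
  set A := Algebra.adjoin k (Set.range z ∪ {(MvPolynomial.aeval z δ)⁻¹})
  let T : Subalgebra k Ω := (Subalgebra.algebraicClosure R Ω).restrictScalars k
  have hzT (i : Fin m) : z i ∈ T := by
    have := isAlgebraic_algebraMap (A := Ω) (MvPolynomial.X i : R)
    rw [hmap, MvPolynomial.aeval_X] at this
    exact this
  have hδT : (MvPolynomial.aeval z δ)⁻¹ ∈ T :=
    (isAlgebraic_algebraMap (A := Ω) (δ : R)).inv
  have hAT : A ≤ T := by
    refine Algebra.adjoin_le ?_
    rintro _ (⟨i, rfl⟩ | rfl)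
    exacts [hzT i, hδT]
  have hzA (r : R) : MvPolynomial.aeval z r ∈ A := by
    have h : MvPolynomial.aeval z r ∈ Algebra.adjoin k (Set.range z) := by
      rw [Algebra.adjoin_range_eq_range_aeval]
      exact ⟨r, rfl⟩
    exact Algebra.adjoin_mono Set.subset_union_left h
  let : Algebra R A := ((MvPolynomial.aeval z : R →ₐ[k] Ω).codRestrict A hzA).toRingHom.toAlgebra
  have : IsScalarTower R A Ω := .of_algebraMap_eq fun _ => rfl
  have : Algebra.IsAlgebraic R A := ⟨fun a => by
    rw [← isAlgebraic_algebraMap_iff (A := Ω) Subtype.val_injective]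
    exact hAT a.2⟩
  have hηT : η ∈ T := IsAlgebraic.restrictScalars R hη.isAlgebraic
  have hDT : Dalg k z δ η ≤ T := by
    refine Algebra.adjoin_le ?_
    rintro _ (⟨i, rfl⟩ | rfl | rfl)
    exacts [hzT i, hδT, hηT]
  exact hDT hx

theorem exists_aeval_mul_mem_Dalg
    (hη : IsIntegral ↥(Algebra.adjoin k (Set.range z ∪ {(MvPolynomial.aeval z δ)⁻¹})) η)
    {b : Dalg k z δ η} (hb : b ≠ 0) :
    ∃ r : MvPolynomial (Fin m) k, r ≠ 0 ∧ ∃ y, b * y = toDalg k z δ η r := by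
  obtain ⟨P, hP, hP0⟩ := exists_eval₂_eq_zero_of_mem_Dalg hη b.2
  refine exists_mul_eq_of_eval₂_eq_zero (toDalg k z δ η).toRingHom hb hP ?_
  apply Subtype.val_injective
  change (Dalg k z δ η).val.toRingHom _ = (Dalg k z δ η).val.toRingHom 0
  rw [hom_eval₂, map_zero]
  exact hP0

theorem exists_aeval_mul_mem_of_mem_Ffield
    (hη : IsIntegral ↥(Algebra.adjoin k (Set.range z ∪ {(MvPolynomial.aeval z δ)⁻¹})) η)
    {x : Ω} (hx : x ∈ Ffield k z δ η) :
    ∃ r : MvPolynomial (Fin m) k, r ≠ 0 ∧ MvPolynomial.aeval z r * x ∈ Dalg k z δ η := by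
  obtain ⟨a, ha, b, hb, rfl⟩ := Subfield.mem_closure_iff.1 hx
  have hcl : Subring.closure (Dalg k z δ η : Set Ω) = (Dalg k z δ η).toSubring :=
    Subring.closure_eq (Dalg k z δ η).toSubring
  rw [hcl] at ha hb
  by_cases hb0 : b = 0
  · exact ⟨1, one_ne_zero, by simp [hb0]⟩
  obtain ⟨r, hr, y, hy⟩ := exists_aeval_mul_mem_Dalg (b := ⟨b, hb⟩) hη
    (fun h => hb0 (congrArg Subtype.val h))
  refine ⟨r, hr, ?_⟩
  have hy' : b * y = MvPolynomial.aeval z r := congrArg Subtype.val hy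
  rw [← hy', show b * (y : Ω) * (a / b) = y * a by field_simp]
  exact mul_mem y.2 ha

theorem exists_aeval_mul_coeff_mem
    (hη : IsIntegral ↥(Algebra.adjoin k (Set.range z ∪ {(MvPolynomial.aeval z δ)⁻¹})) η)
    (p : (Ffield k z δ η)[X]) :
    ∃ r : MvPolynomial (Fin m) k, r ≠ 0 ∧
      ∀ n, MvPolynomial.aeval z r * (p.coeff n : Ω) ∈ Dalg k z δ η := by
  choose r hr hrm using fun n => exists_aeval_mul_mem_of_mem_Ffield hη (p.coeff n).2
  refine ⟨∏ n ∈ p.support, r n, Finset.prod_ne_zero_iff.2 fun n _ => hr n, fun n => ?_⟩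
  by_cases hn : n ∈ p.support
  · rw [← Finset.prod_erase_mul _ _ hn, map_mul, mul_assoc]
    exact mul_mem (aeval_mem k z δ η _) (hrm n)
  · rw [notMem_support_iff.1 hn]
    simp

theorem mem_Dadj_of_dvd {r g : MvPolynomial (Fin m) k} (hrg : r ∣ g)
    (hg : MvPolynomial.aeval z g ≠ 0) {x : Ω}
    (hx : MvPolynomial.aeval z r * x ∈ Dalg k z δ η) :
    x ∈ Dadj k z δ η (toDalg k z δ η g) := by
  obtain ⟨s, rfl⟩ := hrg
  have h1 : (MvPolynomial.aeval z s : Ω) * (MvPolynomial.aeval z r * x) ∈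
      Dadj k z δ η (toDalg k z δ η (r * s)) :=
    le_Dadj k z δ η _ (mul_mem (aeval_mem k z δ η s) hx)
  have h2 : (MvPolynomial.aeval z (r * s) : Ω)⁻¹ ∈ Dadj k z δ η (toDalg k z δ η (r * s)) :=
    Algebra.subset_adjoin (Set.mem_union_right _ rfl)
  have h3 : x = (MvPolynomial.aeval z s * (MvPolynomial.aeval z r * x)) *
      (MvPolynomial.aeval z (r * s))⁻¹ := by
    rw [eq_mul_inv_iff_mul_eq₀ hg, map_mul]
    ring
  rw [h3]
  exact mul_mem h1 h2

theorem exists_pow_mul_mem_Dalg {q : Dalg k z δ η} (hq : q ≠ 0) {x : Ω}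
    (hx : x ∈ Dadj k z δ η q) : ∃ n : ℕ, (q : Ω) ^ n * x ∈ Dalg k z δ η := by
  have hq' : (q : Ω) ≠ 0 := fun h => hq (Subtype.ext h)
  induction hx using Algebra.adjoin_induction with
  | mem x hx =>
    rcases hx with hx | rfl
    · exact ⟨0, by simpa using hx⟩
    · exact ⟨1, by rw [pow_one, mul_inv_cancel₀ hq']; exact one_mem _⟩
  | algebraMap c => exact ⟨0, by simp⟩
  | add x y _ _ hx hy =>
    obtain ⟨a, ha⟩ := hx
    obtain ⟨b, hb⟩ := hy
    refine ⟨a + b, ?_⟩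
    rw [show (q : Ω) ^ (a + b) * (x + y) = q ^ b * (q ^ a * x) + q ^ a * (q ^ b * y) by ring]
    exact add_mem (mul_mem (pow_mem q.2 b) ha) (mul_mem (pow_mem q.2 a) hb)
  | mul x y _ _ hx hy =>
    obtain ⟨a, ha⟩ := hx
    obtain ⟨b, hb⟩ := hy
    refine ⟨a + b, ?_⟩
    rw [show (q : Ω) ^ (a + b) * (x * y) = (q ^ a * x) * (q ^ b * y) by ring]
    exact mul_mem ha hb

theorem Dadj_subset_Ffield (q : Dalg k z δ η) :
    (Dadj k z δ η q : Set Ω) ⊆ (Ffield k z δ η : Set Ω) := by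
  intro x hx
  have hD : ∀ y ∈ Dalg k z δ η, y ∈ Ffield k z δ η := fun y hy => Subfield.subset_closure hy
  induction hx using Algebra.adjoin_induction with
  | mem x hx =>
    rcases hx with hx | rfl
    · exact hD x hx
    · exact inv_mem (hD q q.2)
  | algebraMap c => exact hD _ ((Dalg k z δ η).algebraMap_mem c)
  | add x y _ _ hx hy => exact add_mem hx hy
  | mul x y _ _ hx hy => exact mul_mem hx hy

theorem existsUnique_comp_inclusion_eq {q : Dalg k z δ η} (hq : q ≠ 0)
    (φ : Dalg k z δ η →ₐ[k] kbar) (hφ : φ q ≠ 0) :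
    ∃! ψ : Dadj k z δ η q →ₐ[k] kbar,
      ψ.comp (Subalgebra.inclusion (le_Dadj k z δ η q)) = φ := by
  have hq' : (q : Ω) ≠ 0 := fun h => hq (Subtype.ext h)
  refine existsUnique_comp_eq_of_forall_exists_pow_mul (q := q)
    (Subalgebra.inclusion_injective (le_Dadj k z δ η q)) ?_ (fun x => ?_) (isUnit_iff_ne_zero.2 hφ)
  · refine IsUnit.of_mul_eq_one
      ⟨(q : Ω)⁻¹, Algebra.subset_adjoin (Set.mem_union_right _ rfl)⟩ ?_
    exact Subtype.ext (mul_inv_cancel₀ hq')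
  · obtain ⟨n, hn⟩ := exists_pow_mul_mem_Dalg hq x.2
    refine ⟨n, ⟨(q : Ω) ^ n * x, hn⟩, Subtype.ext ?_⟩
    rw [Subalgebra.coe_mul, Subalgebra.coe_pow, Subalgebra.coe_inclusion,
      Subalgebra.coe_inclusion]

theorem mem_closure_range_of_comp_inclusion_eq {q : Dalg k z δ η} (hq : q ≠ 0)
    {φ : Dalg k z δ η →ₐ[k] kbar} (hφ : φ q ≠ 0) {ψ : Dadj k z δ η q →ₐ[k] kbar}
    (hψ : ψ.comp (Subalgebra.inclusion (le_Dadj k z δ η q)) = φ) (x : Dadj k z δ η q) :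
    ψ x ∈ Subfield.closure (Set.range φ) := by
  obtain ⟨n, hn⟩ := exists_pow_mul_mem_Dalg hq x.2
  let i := Subalgebra.inclusion (le_Dadj k z δ η q)
  have hi : i q ^ n * x = i ⟨(q : Ω) ^ n * x, hn⟩ := Subtype.ext (by
    rw [Subalgebra.coe_mul, Subalgebra.coe_pow, Subalgebra.coe_inclusion,
      Subalgebra.coe_inclusion])
  have hi' (y : Dalg k z δ η) : ψ (i y) = φ y := DFunLike.congr_fun hψ y
  have h1 : φ q ^ n * ψ x = φ ⟨(q : Ω) ^ n * x, hn⟩ := by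
    rw [← hi', ← hi', ← map_pow, ← map_mul, hi]
  rw [← inv_mul_cancel_left₀ (pow_ne_zero n hφ) (ψ x), h1]
  have hφM (y : Dalg k z δ η) : φ y ∈ Subfield.closure (Set.range φ) :=
    Subfield.subset_closure (Set.mem_range_self y)
  exact mul_mem (inv_mem (pow_mem (hφM q) n)) (hφM _)

open IntermediateField in
theorem closure_range_le_adjoin_eta (hδ : MvPolynomial.aeval z δ ≠ 0)
    (φ : Dalg k z δ η →ₐ[k] kbar) :
    Subfield.closure (Set.range φ) ≤
      ((IntermediateField.adjoin k (Set.range fun i => φ ⟨z i, z_mem k z δ η i⟩))⟮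
        φ ⟨η, eta_mem k z δ η⟩⟯).toSubfield := by
  set κ := IntermediateField.adjoin k (Set.range fun i => φ ⟨z i, z_mem k z δ η i⟩)
  set E := κ⟮φ ⟨η, eta_mem k z δ η⟩⟯
  have hκ : ∀ y ∈ κ, y ∈ E := fun y hy => E.algebraMap_mem ⟨y, hy⟩
  have hz' (i : Fin m) : φ ⟨z i, z_mem k z δ η i⟩ ∈ κ := subset_adjoin k _ ⟨i, rfl⟩
  have hpoly (r : MvPolynomial (Fin m) k) : φ (toDalg k z δ η r) ∈ κ := by
    have : φ.comp (toDalg k z δ η) = MvPolynomial.aeval fun i => φ ⟨z i, z_mem k z δ η i⟩ := by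
      ext i
      simp only [AlgHom.comp_apply, MvPolynomial.aeval_X]
      exact congrArg φ (Subtype.ext (MvPolynomial.aeval_X z i))
    rw [← AlgHom.comp_apply, this]
    exact κ.toSubalgebra.mvPolynomial_aeval_coe (fun i => ⟨_, hz' i⟩) r ▸ SetLike.coe_mem _
  have hinv : (MvPolynomial.aeval z δ)⁻¹ ∈ Dalg k z δ η :=
    Algebra.subset_adjoin (Set.mem_union_right _ (by simp))
  rw [Subfield.closure_le]
  rintro _ ⟨⟨x, hx⟩, rfl⟩
  change φ ⟨x, hx⟩ ∈ E
  unfold Dalg at hx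
  induction hx using Algebra.adjoin_induction with
  | mem x hx =>
    rcases hx with ⟨i, rfl⟩ | rfl | rfl
    · exact hκ _ (hz' i)
    · refine hκ _ ?_
      have h1 : φ ⟨_, hinv⟩ * φ (toDalg k z δ η δ) = 1 := by
        rw [← map_mul, ← map_one φ]
        exact congrArg φ (Subtype.ext (inv_mul_cancel₀ hδ))
      rw [eq_inv_of_mul_eq_one_left h1]
      exact inv_mem (hpoly δ)
    · exact mem_adjoin_simple_self κ _
  | algebraMap c =>
    have : φ ⟨algebraMap k Ω c, (Dalg k z δ η).algebraMap_mem c⟩ = algebraMap k kbar c :=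
      φ.commutes c
    exact this ▸ hκ _ (κ.algebraMap_mem c)
  | add x y hx hy hx' hy' => exact map_add φ ⟨x, hx⟩ ⟨y, hy⟩ ▸ add_mem hx' hy'
  | mul x y hx hy hx' hy' => exact map_mul φ ⟨x, hx⟩ ⟨y, hy⟩ ▸ mul_mem hx' hy'

theorem exists_map_val_eq {q : Dalg k z δ η} {p : (Ffield k z δ η)[X]}
    (hp : ∀ n, (p.coeff n : Ω) ∈ Dadj k z δ η q) :
    ∃ p' : (Dadj k z δ η q)[X],
      p'.map (Dadj k z δ η q).val.toRingHom = p.map (Ffield k z δ η).subtype := by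
  have h : p.map (Ffield k z δ η).subtype ∈ lifts (Dadj k z δ η q).val.toRingHom := by
    rw [lifts_iff_coeff_lifts]
    intro n
    rw [coeff_map]
    exact ⟨⟨_, hp n⟩, rfl⟩
  exact (mem_lifts _).1 h

theorem map_toDalg_eq_algebraMap_aeval (φ : Dalg k z δ η →ₐ[k] kbar)
    (r : MvPolynomial (Fin m) k) :
    φ (toDalg k z δ η r) = algebraMap
      (IntermediateField.adjoin k (Set.range fun i => φ ⟨z i, z_mem k z δ η i⟩)) kbar
      (MvPolynomial.aeval (fun i =>
        (⟨φ ⟨z i, z_mem k z δ η i⟩, IntermediateField.subset_adjoin k _ ⟨i, rfl⟩⟩ :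
          IntermediateField.adjoin k (Set.range fun i => φ ⟨z i, z_mem k z δ η i⟩))) r) := by
  rw [← MvPolynomial.aeval_algebraMap_apply, ← AlgHom.comp_apply]
  congr 1
  ext i
  simp only [AlgHom.comp_apply, MvPolynomial.aeval_X]
  exact congrArg φ (Subtype.ext (MvPolynomial.aeval_X z i))

variable (k z δ η) in
/-- Evaluation at `z` as a map `k[z] → F`. -/
noncomputable def toFfield : MvPolynomial (Fin m) k →+* Ffield k z δ η :=
  (MvPolynomial.aeval z : MvPolynomial (Fin m) k →ₐ[k] Ω).toRingHom.codRestrict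
    (Ffield k z δ η) fun r => Subfield.subset_closure (aeval_mem k z δ η r)

variable (k z δ η) in
theorem closure_range_toFfield_eq_top :
    Subfield.closure (Set.range (toFfield k z δ η) ∪
      {⟨η, Subfield.subset_closure (eta_mem k z δ η)⟩}) = ⊤ := by
  set S := Subfield.closure (Set.range (toFfield k z δ η) ∪
      {(⟨η, Subfield.subset_closure (eta_mem k z δ η)⟩ : Ffield k z δ η)})
  let T := S.map (Ffield k z δ η).subtype
  have hRT (r : MvPolynomial (Fin m) k) : MvPolynomial.aeval z r ∈ T :=
    ⟨toFfield k z δ η r, Subfield.subset_closure (Or.inl ⟨r, rfl⟩), rfl⟩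
  have hle : Ffield k z δ η ≤ T := by
    refine Subfield.closure_le.2 fun x hx => ?_
    change x ∈ T
    change x ∈ Dalg k z δ η at hx
    unfold Dalg at hx
    induction hx using Algebra.adjoin_induction with
    | mem x hx =>
      rcases hx with ⟨i, rfl⟩ | rfl | rfl
      · simpa using hRT (MvPolynomial.X i)
      · exact inv_mem (hRT δ)
      · exact ⟨_, Subfield.subset_closure (Or.inr rfl), rfl⟩
    | algebraMap c => simpa using hRT (MvPolynomial.C c)
    | add x y _ _ hx hy => exact add_mem hx hy
    | mul x y _ _ hx hy => exact mul_mem hx hy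
  rw [eq_top_iff]
  intro x _
  obtain ⟨y, hy, hyx⟩ := hle x.2
  rwa [← Subtype.ext hyx]

end Specialization

/-- Lemma 2.11 of the paper. -/
theorem irreducible_specialization
    {Ω : Type*} [Field Ω] [IsAlgClosed Ω] [CharZero Ω]
    (k : Type*) [Field k] [Algebra k Ω]
    (kbar : Type*) [Field kbar] [Algebra k kbar] [IsAlgClosure k kbar]
    {m : ℕ} (z : Fin m → Ω) (δ : MvPolynomial (Fin m) k) (η : Ω)
    -- hypothesis (H)
    (hm : 0 < m) (hz : AlgebraicIndependent k z) (hδ : δ ≠ 0)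
    (hη : IsIntegral ↥(Algebra.adjoin k (Set.range z ∪ {(MvPolynomial.aeval z δ)⁻¹})) η)
    (f : Polynomial ↥(Ffield k z δ η)) (hf : Irreducible f)
    (b : ↥(Dalg k z δ η)) (hb : b ≠ 0) :
    ∃ (h : Polynomial (MvPolynomial (Fin m) k)) (g : MvPolynomial (Fin m) k)
      (q : ↥(Dalg k z δ η)),
      Irreducible h ∧ 0 < h.natDegree ∧ g ≠ 0 ∧ q ≠ 0 ∧
      -- `D[1/q] ⊆ F`
      (Dadj k z δ η q : Set Ω) ⊆ (Ffield k z δ η : Set Ω) ∧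
      -- every coefficient of `f` lies in `D[1/q]`
      ∃ hcoeff : ∀ n : ℕ, (f.coeff n : Ω) ∈ Dadj k z δ η q,
        ∀ d : ℕ, 0 < d → ∀ φ ∈ Hset k kbar z δ η d {h} g,
          -- `φ(q) ≠ 0` and `φ(b) ≠ 0`
          φ q ≠ 0 ∧ φ b ≠ 0 ∧
          -- `φ` extends uniquely to `D[1/q]`
          (∃! ψ : ↥(Dadj k z δ η q) →ₐ[k] kbar,
            ψ.comp (Subalgebra.inclusion (le_Dadj k z δ η q)) = φ) ∧
          -- and for the extension `ψ`, the specialized polynomial `φ(f)` is a polynomial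
          -- over the field `φ(D)`, is irreducible there, and has the same degree as `f`
          ∀ ψ : ↥(Dadj k z δ η q) →ₐ[k] kbar,
            ψ.comp (Subalgebra.inclusion (le_Dadj k z δ η q)) = φ →
            ∃ fbar : Polynomial ↥(Subfield.closure (Set.range ⇑φ)),
              (∀ n : ℕ, (fbar.coeff n : kbar) = ψ ⟨(f.coeff n : Ω), hcoeff n⟩) ∧
              Irreducible fbar ∧ fbar.natDegree = f.natDegree := by
  let R := MvPolynomial (Fin m) k
  have hinj : Function.Injective (MvPolynomial.aeval z : R →ₐ[k] Ω) := hz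
  have hne {r : R} (hr : r ≠ 0) : MvPolynomial.aeval z r ≠ 0 := (map_ne_zero_iff _ hinj).2 hr
  have : CharZero k := (algebraMap k Ω).charZero
  let F := Ffield k z δ η
  let : Algebra R F := (toFfield k z δ η).toAlgebra
  have hRF : F.subtype.comp (algebraMap R F) =
      (MvPolynomial.aeval z : R →ₐ[k] Ω).toRingHom := rfl
  have hinjF : Function.Injective (algebraMap R F) := fun x y hxy =>
    hinj (congrArg Subtype.val hxy)
  have : FaithfulSMul R F := (faithfulSMul_iff_algebraMap_injective R F).2 hinjF
  let ηF : F := ⟨η, Subfield.subset_closure (eta_mem k z δ η)⟩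
  have hηF : IsAlgebraic R ηF := by
    obtain ⟨P, hP, hP0⟩ := exists_eval₂_eq_zero_of_mem_Dalg hη (eta_mem k z δ η)
    refine ⟨P, hP, F.subtype_injective ?_⟩
    rw [aeval_def, hom_eval₂, hRF, map_zero]
    exact hP0
  obtain ⟨h, P, W, hmonic, hirr, hP, hPη, hdeg, Q, hQ⟩ :=
    exists_monic_irreducible_dvd_comp ηF hηF (closure_range_toFfield_eq_top k z δ η) f hf
  have hlc : f.leadingCoeff ≠ 0 := leadingCoeff_ne_zero.2 hf.ne_zero
  obtain ⟨rf, hrf, hrf'⟩ := exists_aeval_mul_coeff_mem hη f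
  obtain ⟨rW, hrW, hrW'⟩ := exists_aeval_mul_coeff_mem hη W
  obtain ⟨rQ, hrQ, hrQ'⟩ := exists_aeval_mul_coeff_mem hη Q
  obtain ⟨ru, hru, hru'⟩ := exists_aeval_mul_mem_of_mem_Ffield hη (f.leadingCoeff⁻¹).2
  obtain ⟨rb, hrb, y, hy⟩ := exists_aeval_mul_mem_Dalg hη hb
  have hPlc : P.leadingCoeff ≠ 0 := leadingCoeff_ne_zero.2 hP
  obtain ⟨g, hg⟩ : ∃ g, g = rf * rW * rQ * ru * rb * P.leadingCoeff := ⟨_, rfl⟩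
  have hg0 : g ≠ 0 := by
    rw [hg]
    exact mul_ne_zero (mul_ne_zero (mul_ne_zero (mul_ne_zero (mul_ne_zero hrf hrW) hrQ) hru) hrb)
      hPlc
  have hf_dvd : rf ∣ g := ⟨rW * rQ * ru * rb * P.leadingCoeff, by rw [hg]; ring⟩
  have hW_dvd : rW ∣ g := ⟨rf * rQ * ru * rb * P.leadingCoeff, by rw [hg]; ring⟩
  have hQ_dvd : rQ ∣ g := ⟨rf * rW * ru * rb * P.leadingCoeff, by rw [hg]; ring⟩
  have hu_dvd : ru ∣ g := ⟨rf * rW * rQ * rb * P.leadingCoeff, by rw [hg]; ring⟩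
  have hb_dvd : rb ∣ g := ⟨rf * rW * rQ * ru * P.leadingCoeff, by rw [hg]; ring⟩
  have hP_dvd : P.leadingCoeff ∣ g := ⟨rf * rW * rQ * ru * rb, by rw [hg]; ring⟩
  set q := toDalg k z δ η g with hq
  have hq0 : q ≠ 0 := fun h0 => hne hg0 (congrArg Subtype.val h0)
  have hcoeff (n : ℕ) : (f.coeff n : Ω) ∈ Dadj k z δ η q :=
    mem_Dadj_of_dvd hf_dvd (hne hg0) (hrf' n)
  refine ⟨h, g, q, hirr, hmonic.natDegree_pos.2 hirr.ne_one, hg0, hq0,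
    Dadj_subset_Ffield q, hcoeff, fun d _ φ hφ => ?_⟩
  obtain ⟨hφg, -, hφh⟩ := hφ
  have hφq : φ q ≠ 0 := hφg
  have hφ_dvd {r : R} (hr : r ∣ g) : φ (toDalg k z δ η r) ≠ 0 := by
    obtain ⟨s, hs⟩ := hr
    rw [hq, hs, map_mul, map_mul] at hφq
    exact left_ne_zero_of_mul hφq
  refine ⟨hφq, ?_, existsUnique_comp_inclusion_eq hq0 φ hφq, fun ψ hψ => ?_⟩
  · have := hφ_dvd hb_dvd
    rw [← hy, map_mul] at this
    exact left_ne_zero_of_mul this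
  let M := Subfield.closure (Set.range φ)
  have hψM := mem_closure_range_of_comp_inclusion_eq hq0 hφq hψ
  let i := Subalgebra.inclusion (le_Dadj k z δ η q)
  have hψi (x : Dalg k z δ η) : ψ (i x) = φ x := DFunLike.congr_fun hψ x
  let ι : R →+* Dadj k z δ η q := i.toRingHom.comp (toDalg k z δ η).toRingHom
  let v : Dadj k z δ η q →+* Ω := (Dadj k z δ η q).val.toRingHom
  have hv : Function.Injective v := Subtype.val_injective
  have hvι : v.comp ι = F.subtype.comp (algebraMap R F) := rfl
  obtain ⟨f', hf'⟩ := exists_map_val_eq hcoeff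
  obtain ⟨W', hW'⟩ := exists_map_val_eq fun n => mem_Dadj_of_dvd hW_dvd (hne hg0) (hrW' n)
  obtain ⟨Q', hQ'⟩ := exists_map_val_eq fun n => mem_Dadj_of_dvd hQ_dvd (hne hg0) (hrQ' n)
  have hf'deg : f'.natDegree = f.natDegree := by
    rw [← natDegree_map_eq_of_injective hv, ← natDegree_map_eq_of_injective F.subtype_injective f]
    exact congrArg natDegree hf'
  have hf'coeff (n : ℕ) : f'.coeff n = ⟨(f.coeff n : Ω), hcoeff n⟩ := by
    have := congrArg (fun p => p.coeff n) hf'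
    simp only [coeff_map] at this
    exact Subtype.ext this
  have hψlc : ψ f'.leadingCoeff ≠ 0 := by
    have hu : f'.leadingCoeff * ⟨((f.leadingCoeff⁻¹ : F) : Ω),
        mem_Dadj_of_dvd hu_dvd (hne hg0) hru'⟩ = 1 := by
      rw [leadingCoeff, hf'deg, hf'coeff]
      exact Subtype.ext (congrArg (Subtype.val : F → Ω) (mul_inv_cancel₀ hlc))
    intro h0
    have := congrArg ψ hu
    rw [map_mul, h0, zero_mul, map_one] at this
    exact zero_ne_one this
  let ψM : Dadj k z δ η q →+* M := ψ.toRingHom.codRestrict M hψM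
  have hψM_comp : M.subtype.comp ψM = ψ.toRingHom := rfl
  have hfMdeg : (f'.map ψM).natDegree = f'.natDegree :=
    natDegree_map_of_leadingCoeff_ne_zero _ fun h0 => hψlc (congrArg Subtype.val h0)
  refine ⟨f'.map ψM, fun n => ?_, ?_, hfMdeg.trans hf'deg⟩
  · rw [coeff_map, hf'coeff]
    rfl
  let κ := IntermediateField.adjoin k (Set.range fun i => φ ⟨z i, z_mem k z δ η i⟩)
  let ρ : R →ₐ[k] κ := MvPolynomial.aeval fun i =>
    (⟨φ ⟨z i, z_mem k z δ η i⟩, IntermediateField.subset_adjoin k _ ⟨i, rfl⟩⟩ : κ)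
  have hφρ (r : R) : φ (toDalg k z δ η r) = algebraMap κ kbar (ρ r) :=
    map_toDalg_eq_algebraMap_aeval φ r
  have : IsAlgClosed kbar := IsAlgClosure.isAlgClosed k
  have : Algebra.IsAlgebraic k kbar := IsAlgClosure.isAlgebraic
  have : Algebra.IsAlgebraic κ kbar := Algebra.IsAlgebraic.tower_top (K := k) κ
  have hPρ : P.map ρ.toRingHom ≠ 0 := by
    intro h0
    have h1 := congrArg (fun p => p.coeff P.natDegree) h0
    simp only [coeff_map, coeff_zero] at h1
    refine hφ_dvd hP_dvd ?_
    rw [hφρ]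
    exact (congrArg (algebraMap κ kbar) h1).trans (map_zero _)
  have hPβ : aeval (φ ⟨η, eta_mem k z δ η⟩) (P.map ρ.toRingHom) = 0 := by
    have hD : eval₂ (toDalg k z δ η).toRingHom ⟨η, eta_mem k z δ η⟩ P = 0 := by
      apply Subtype.val_injective
      change (Dalg k z δ η).val.toRingHom _ = (Dalg k z δ η).val.toRingHom 0
      rw [hom_eval₂, map_zero]
      have := congrArg F.subtype hPη
      rw [aeval_def, hom_eval₂, map_zero] at this
      exact this
    have h1 := congrArg φ.toRingHom hD
    rw [hom_eval₂, map_zero] at h1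
    rw [aeval_def, eval₂_map]
    have hc : (algebraMap κ kbar).comp ρ.toRingHom =
        φ.toRingHom.comp (toDalg k z δ η).toRingHom := RingHom.ext fun r => (hφρ r).symm
    rw [hc]
    exact h1
  have hdvd : (h.map ι).comp W' = f' * Q' := by
    apply map_injective v hv
    have h1 := congrArg (Polynomial.map F.subtype) hQ
    rw [Polynomial.map_comp, Polynomial.map_mul, Polynomial.map_map] at h1 ⊢
    rw [hvι, hf', hW', hQ']
    exact h1
  refine irreducible_of_dvd_comp_of_natDegree_eq ι ψ.toRingHom ρ.toRingHom
    (fun r => (hψi _).trans (hφρ r)) (φ ⟨η, eta_mem k z δ η⟩) M hψM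
    (closure_range_le_adjoin_eta (hne hδ) φ) h P f' W' Q' hmonic
    (hφh h (Finset.mem_singleton_self h)).2 hPρ hPβ (by rw [hdeg, hf'deg]) hdvd (f'.map ψM) ?_
    hfMdeg ?_
  · rw [Polynomial.map_map, hψM_comp]
  · rw [hf'deg]
    exact hf.natDegree_pos
end
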